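/- Let n ≥ 3 and let A₁, …, A_{n−1} be cochain complexes of k-modules with chain maps aᵢ : Aᵢ → A_{i+1}. Define the Coxeter transform c(A₁ → … → A_{n−1}) to be the sequence whose i-th complex is C(aᵢ ∘ ⋯ ∘ a₁) for 1 ≤ i ≤ n−2 and whose (n−1)-st complex is A₁[1], with structure maps diag(id_{A₁[1]}, a_{i+1}) : C(aᵢ∘⋯∘a₁) → C(a_{i+1}∘⋯∘a₁) for i ≤ n−3 and the projection (id, 0) : C(a_{n−2}∘⋯∘a₁) → A₁[1]. Then the n-fold iterate cⁿ of the Coxeter transform applied to (A₁ → … → A_{n−1}) is homotopy equivalent to the shifted sequence (A₁[2] → … → A_{n−1}[2]): for each i there is a homotopy equivalence φᵢ from the i-th complex of cⁿ(A) to Aᵢ[2], together with degree −1 morphisms hᵢ with dhᵢ = φ_{i+1} ∘ (i-th structure map of cⁿ(A)) − aᵢ[2] ∘ φᵢ, so all squares commute up to the specified homotopies. -/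

import Mathlib

namespace ThesisDG

universe u

/-- A `ℤ`-indexed family of `k`-modules together with maps `d i j` (morally supported
on `j = i + 1`).  The axioms of a cochain complex are recorded separately in
`Cx.IsComplex`. -/
structure Cx (k : Type u) [CommRing k] where
  X : ℤ → Type u
  [grp : ∀ i, AddCommGroup (X i)]
  [mod : ∀ i, Module k (X i)]
  d : ∀ i j : ℤ, X i →ₗ[k] X j

attribute [instance] Cx.grp Cx.mod

variable {k : Type u} [CommRing k]

/-- `A` is a genuine cochain complex: the differential is supported in degree `+1`
and squares to zero. -/
def Cx.IsComplex (A : Cx k) : Prop :=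
  (∀ i j : ℤ, i + 1 ≠ j → A.d i j = 0) ∧ ∀ i j l : ℤ, (A.d j l).comp (A.d i j) = 0

/-- Graded morphisms between two graded objects: doubly indexed families of `k`-linear
maps `A.X i →ₗ[k] B.X j`.  A degree-`n` morphism is such a family supported on
`j = i + n`, see `Mor.HasDeg`. -/
abbrev Mor (A B : Cx k) := ∀ i j : ℤ, A.X i →ₗ[k] B.X j

/-- `f` is homogeneous of degree `n`, i.e. supported on `j = i + n`. -/
def Mor.HasDeg {A B : Cx k} (f : Mor A B) (n : ℤ) : Prop :=
  ∀ i j : ℤ, i + n ≠ j → f i j = 0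

/-- The differential `df = d_B ∘ f - (-1)ⁿ f ∘ d_A` of a degree-`n` morphism `f`. -/
def Mor.diff {A B : Cx k} (n : ℤ) (f : Mor A B) : Mor A B := fun i j =>
  (B.d (i + n) j).comp (f i (i + n)) -
    (n.negOnePow : ℤ) • ((f (i + 1) j).comp (A.d i (i + 1)))

/-- Composition `g ∘ f` (the morphism `f`, of degree `m`, is applied first). -/
def Mor.comp {A B C : Cx k} (g : Mor B C) (f : Mor A B) (m : ℤ) : Mor A C := fun i j =>
  (g (i + m) j).comp (f i (i + m))

/-- Transport along an equality of degrees. -/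
def Cx.cast (A : Cx k) : ∀ {i j : ℤ}, i = j → (A.X i →ₗ[k] A.X j)
  | _, _, rfl => LinearMap.id

/-- The identity (degree-`0`) morphism. -/
def idM (A : Cx k) : Mor A A := fun i j => if h : i = j then A.cast h else 0

/-- `f` is closed as a degree-`n` morphism: `df = 0`. -/
def IsClosed {A B : Cx k} (n : ℤ) (f : Mor A B) : Prop := Mor.diff n f = 0

/-- A chain map is a closed morphism of degree `0`. -/
def IsChainMap {A B : Cx k} (f : Mor A B) : Prop := Mor.HasDeg f 0 ∧ IsClosed 0 f

/-- Two degree-`n` morphisms are homotopic if their difference is the differential of a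
morphism of degree `n - 1`. -/
def Homotopic {A B : Cx k} (n : ℤ) (f g : Mor A B) : Prop :=
  ∃ s : Mor A B, Mor.HasDeg s (n - 1) ∧ Mor.diff (n - 1) s = f - g

/-- `g` is a homotopy inverse of the chain map `f`: both are chain maps and both
composites are homotopic to the identity. -/
def AreHtpyInverse {A B : Cx k} (f : Mor A B) (g : Mor B A) : Prop :=
  IsChainMap f ∧ IsChainMap g ∧
    Homotopic 0 (Mor.comp g f 0) (idM A) ∧ Homotopic 0 (Mor.comp f g 0) (idM B)

/-- A chain map is a homotopy equivalence if it admits a homotopy inverse. -/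
def IsHtpyEquiv {A B : Cx k} (f : Mor A B) : Prop := ∃ g : Mor B A, AreHtpyInverse f g

/-- The mapping cone `C(a)`: `C(a)ⁱ = A₁^{i+1} × A₂^{i}`, with differential
`[[-d, 0], [a, d]]`. -/
def cone {A₁ A₂ : Cx k} (a : Mor A₁ A₂) : Cx k where
  X i := A₁.X (i + 1) × A₂.X i
  d i j := LinearMap.prod
    ((-(A₁.d (i + 1) (j + 1))).comp (LinearMap.fst k (A₁.X (i + 1)) (A₂.X i)))
    ((a (i + 1) j).comp (LinearMap.fst k (A₁.X (i + 1)) (A₂.X i)) +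
      (A₂.d i j).comp (LinearMap.snd k (A₁.X (i + 1)) (A₂.X i)))

/-- The shift `A[n]`: `A[n]ⁱ = A^{i+n}`, with differential `(-1)ⁿ d`. -/
def shiftCx (A : Cx k) (n : ℤ) : Cx k where
  X i := A.X (i + n)
  d i j := (n.negOnePow : ℤ) • A.d (i + n) (j + n)

/-- The matrix `[[f₁, 0], [h₁, f₂]]` as a graded morphism `C(a) → C(b)`. -/
def coneMap {A₁ A₂ B₁ B₂ : Cx k} (a : Mor A₁ A₂) (b : Mor B₁ B₂)
    (f₁ : Mor A₁ B₁) (h₁ : Mor A₁ B₂) (f₂ : Mor A₂ B₂) :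
    Mor (cone a) (cone b) := fun i j =>
  LinearMap.prod
    ((f₁ (i + 1) (j + 1)).comp (LinearMap.fst k (A₁.X (i + 1)) (A₂.X i)))
    ((h₁ (i + 1) j).comp (LinearMap.fst k (A₁.X (i + 1)) (A₂.X i)) +
      (f₂ i j).comp (LinearMap.snd k (A₁.X (i + 1)) (A₂.X i)))

/-- Sequences of graded objects and morphisms, extended by junk to all of `ℕ`
(only a finite window is ever relevant). -/
structure Seq (k : Type u) [CommRing k] where
  A : ℕ → Cx k
  a : ∀ i : ℕ, Mor (A i) (A (i + 1))

/-- The zero complex. -/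
def zeroCx (k : Type u) [CommRing k] : Cx k where
  X _ := PUnit
  d _ _ := 0

/-- The iterated composite `aᵢ ∘ ⋯ ∘ a₀`. -/
def Seq.abar {k : Type u} [CommRing k] (S : Seq k) : ∀ i : ℕ, Mor (S.A 0) (S.A (i + 1))
  | 0 => S.a 0
  | i + 1 => Mor.comp (S.a (i + 1)) (Seq.abar S i) 0

/-- The complexes of the Coxeter transform (with parameter `n`, for a sequence
occupying the window `0, …, n - 2`): the `i`-th complex is `C(aᵢ ∘ ⋯ ∘ a₀)` for
`i ≤ n - 3`, the `(n - 2)`-nd is `A₀[1]`, and beyond the window we put `0`. -/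
def coxA (n : ℕ) (S : Seq k) (i : ℕ) : Cx k :=
  if i + 2 < n then cone (S.abar i)
  else if i + 2 = n then shiftCx (S.A 0) 1
  else zeroCx k

/-- The structure maps of the Coxeter transform: `diag(id, a_{i+1})` within the window,
and the projection `(id, 0) : C(a_{n-3} ∘ ⋯ ∘ a₀) → A₀[1]` at the end. -/
def coxa (n : ℕ) (S : Seq k) (i : ℕ) : Mor (coxA n S i) (coxA n S (i + 1)) := by
  unfold coxA
  by_cases h1 : i + 2 < n
  · by_cases h2 : i + 1 + 2 < n
    · rw [if_pos h1, if_pos h2]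
      exact coneMap (S.abar i) (S.abar (i + 1)) (idM (S.A 0)) 0 (S.a (i + 1))
    · by_cases h3 : i + 1 + 2 = n
      · rw [if_pos h1, if_neg h2, if_pos h3]
        exact fun p q => (idM (S.A 0) (p + 1) (q + 1)).comp
          (LinearMap.fst k ((S.A 0).X (p + 1)) ((S.A (i + 1)).X p))
      · exact 0
  · exact 0

/-- The Coxeter transform of a sequence. -/
def cox (n : ℕ) (S : Seq k) : Seq k := ⟨coxA n S, coxa n S⟩

/-- Shift of a morphism. -/
def shiftMor {A B : Cx k} (f : Mor A B) (n : ℤ) : Mor (shiftCx A n) (shiftCx B n) :=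
  fun i j => f (i + n) (j + n)

/-- The sequence shifted by `[2]`. -/
def Seq.shift2 {k : Type u} [CommRing k] (S : Seq k) : Seq k where
  A i := shiftCx (S.A i) 2
  a i := shiftMor (S.a i) 2

/-- A `ℤ`-graded module with a degree-one endomorphism, indexed without redundancy. -/
structure DCx (k : Type u) [CommRing k] where
  X : ℤ → Type u
  [grp : ∀ p, AddCommGroup (X p)]
  [mod : ∀ p, Module k (X p)]
  d : ∀ p : ℤ, X p →ₗ[k] X (p + 1)

attribute [instance] DCx.grp DCx.mod

namespace DCx

/-- The differential squares to zero. -/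
def IsCplx (A : DCx k) : Prop := ∀ p x, A.d (p + 1) (A.d p x) = 0

/-- Degree-`0` families of linear maps. -/
abbrev Fam (A B : DCx k) := ∀ p : ℤ, A.X p →ₗ[k] B.X p

/-- The identity family. -/
abbrev idF (A : DCx k) : Fam A A := fun _ => LinearMap.id

/-- Composition of degree-`0` families. -/
abbrev Fam.comp {A B C : DCx k} (g : Fam B C) (f : Fam A B) : Fam A C := fun p => (g p).comp (f p)

/-- Compatibility of a degree-`0` family with the differentials. -/
def IsChain {A B : DCx k} (f : Fam A B) : Prop := ∀ p x, B.d p (f p x) = f (p + 1) (A.d p x)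

/-- `s` is a homotopy witnessing `ds + sd = f - g`. -/
def IsHtpy {A B : DCx k} (f g : Fam A B) (s : ∀ p, A.X (p + 1) →ₗ[k] B.X p) : Prop :=
  ∀ p x, B.d p (s p x) + s (p + 1) (A.d (p + 1) x) = f (p + 1) x - g (p + 1) x

/-- Chain homotopy of degree-`0` families. -/
def Htpic {A B : DCx k} (f g : Fam A B) : Prop := ∃ s, IsHtpy f g s

/-- Homotopy equivalences. -/
def IsHE {A B : DCx k} (f : Fam A B) : Prop :=
  IsChain f ∧ ∃ g : Fam B A, IsChain g ∧ Htpic (Fam.comp g f) (idF A) ∧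
    Htpic (Fam.comp f g) (idF B)

variable {A B C A' B' : DCx k}

theorem isChain_id (A : DCx k) : IsChain (idF A) := fun _ _ => rfl

theorem IsChain.comp {g : Fam B C} {f : Fam A B} (hg : IsChain g) (hf : IsChain f) :
    IsChain (Fam.comp g f) := fun p x => by
  simp [hg p (f p x), hf p x]

theorem Htpic.of_eq {f g : Fam A B} (h : ∀ p x, f p x = g p x) : Htpic f g :=
  ⟨0, fun p x => by simp [h]⟩

theorem Htpic.symm {f g : Fam A B} : Htpic f g → Htpic g f := by
  rintro ⟨s, hs⟩
  refine ⟨fun p => -s p, fun p x => ?_⟩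
  have := hs p x
  simp only [LinearMap.neg_apply, map_neg]
  rw [← neg_add, this, neg_sub]

theorem Htpic.trans {f g h : Fam A B} : Htpic f g → Htpic g h → Htpic f h := by
  rintro ⟨s, hs⟩ ⟨t, ht⟩
  refine ⟨fun p => s p + t p, fun p x => ?_⟩
  have h1 := hs p x
  have h2 := ht p x
  simp only [LinearMap.add_apply, map_add]
  rw [add_add_add_comm, h1, h2, sub_add_sub_cancel]

theorem Htpic.comp_left {f f' : Fam A B} {g : Fam B C} (hg : IsChain g) :
    Htpic f f' → Htpic (Fam.comp g f) (Fam.comp g f') := by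
  rintro ⟨s, hs⟩
  refine ⟨fun p => (g p).comp (s p), fun p x => ?_⟩
  simp [hg p, ← map_add, hs p x]

theorem Htpic.comp_right {f f' : Fam B C} {g : Fam A B} (hg : IsChain g) :
    Htpic f f' → Htpic (Fam.comp f g) (Fam.comp f' g) := by
  rintro ⟨s, hs⟩
  refine ⟨fun p => (s p).comp (g (p + 1)), fun p x => ?_⟩
  have := hs p (g (p + 1) x)
  simp [← hg (p + 1) x, this]

theorem IsHE.of_inverse {f : Fam A B} (hf : IsChain f) {g g' : Fam B A} (hg : IsChain g)
    (hg' : IsChain g') (h : Htpic (Fam.comp g f) (idF A)) (h' : Htpic (Fam.comp f g') (idF B)) :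
    IsHE f := by
  refine ⟨hf, g, hg, h, ?_⟩
  have e : Htpic g g' := (h'.comp_left hg).symm.trans (h.comp_right hg')
  exact (e.comp_left hf).trans h'

theorem IsHE.of_strict {f : Fam A B} {g : Fam B A} (hf : IsChain f) (hg : IsChain g)
    (h : ∀ p x, g p (f p x) = x) (h' : ∀ p x, f p (g p x) = x) : IsHE f :=
  ⟨hf, g, hg, .of_eq h, .of_eq h'⟩

theorem IsHE.comp {g : Fam B C} {f : Fam A B} (hg : IsHE g) (hf : IsHE f) :
    IsHE (Fam.comp g f) := by
  obtain ⟨cg, g', cg', h1, h2⟩ := hg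
  obtain ⟨cf, f', cf', h3, h4⟩ := hf
  refine ⟨cg.comp cf, Fam.comp f' g', cf'.comp cg', ?_, ?_⟩
  · exact ((h1.comp_right cf).comp_left cf').trans h3
  · exact ((h4.comp_right cg').comp_left cg).trans h2

theorem IsHE.congr {f f' : Fam A B} (hf : IsHE f) (hf' : IsChain f') (h : Htpic f f') :
    IsHE f' := by
  obtain ⟨cf, g, cg, h1, h2⟩ := hf
  exact ⟨hf', g, cg, (h.symm.comp_left cg).trans h1, (h.symm.comp_right cg).trans h2⟩

/-- The mapping cone. -/
def cone (a : Fam A B) : DCx k where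
  X p := A.X (p + 1) × B.X p
  d p := LinearMap.prod
    ((-(A.d (p + 1))).comp (LinearMap.fst k (A.X (p + 1)) (B.X p)))
    ((a (p + 1)).comp (LinearMap.fst k (A.X (p + 1)) (B.X p)) +
      (B.d p).comp (LinearMap.snd k (A.X (p + 1)) (B.X p)))

/-- The shift by one. -/
def shift (A : DCx k) : DCx k where
  X p := A.X (p + 1)
  d p := -A.d (p + 1)

/-- The shift of a family. -/
def shiftF (f : Fam A B) : Fam (shift A) (shift B) := fun p => f (p + 1)

/-- The projection from the cone to the shifted source. -/
def coneFst (a : Fam A B) : Fam (cone a) (shift A) :=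
  fun p => LinearMap.fst k (A.X (p + 1)) (B.X p)

theorem IsChain.shiftF {f : Fam A B} (hf : IsChain f) : IsChain (shiftF f) := fun p x => by
  change -B.d (p + 1) (f (p + 1) x) = f (p + 1 + 1) (-A.d (p + 1) x)
  rw [hf (p + 1) x, map_neg]

theorem Htpic.shiftF {f g : Fam A B} : Htpic f g → Htpic (shiftF f) (shiftF g) := by
  rintro ⟨s, hs⟩
  refine ⟨fun p => -s (p + 1), fun p x => ?_⟩
  change -B.d (p + 1) (-s (p + 1) x) + -s (p + 1 + 1) (-A.d (p + 1 + 1) x) =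
    f (p + 1 + 1) x - g (p + 1 + 1) x
  rw [map_neg, map_neg, neg_neg, neg_neg, hs (p + 1) x]

theorem IsHE.shiftF {f : Fam A B} : IsHE f → IsHE (shiftF f) := by
  rintro ⟨cf, g, cg, h1, h2⟩
  exact ⟨cf.shiftF, DCx.shiftF g, cg.shiftF, h1.shiftF, h2.shiftF⟩

theorem isCplx_cone {a : Fam A B} (hA : IsCplx A) (hB : IsCplx B) (ha : IsChain a) :
    IsCplx (cone a) := by
  rintro p ⟨x, y⟩
  refine Prod.ext ?_ ?_
  · change -A.d (p + 1 + 1) (-A.d (p + 1) x) = 0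
    rw [map_neg, hA, neg_zero, neg_zero]
  · change a (p + 1 + 1) (-A.d (p + 1) x) + B.d (p + 1) (a (p + 1) x + B.d p y) = 0
    rw [map_neg, map_add, hB, ha, add_zero, neg_add_cancel]

theorem isChain_coneFst (a : Fam A B) : IsChain (coneFst a) := fun _ _ => rfl

/-- The map of cones with matrix `[[f, 0], [h, g]]`. -/
def coneMap (a : Fam A B) (b : Fam A' B') (f : Fam A A') (h : ∀ p, A.X (p + 1) →ₗ[k] B'.X p)
    (g : Fam B B') : Fam (cone a) (cone b) := fun p => LinearMap.prod
    ((f (p + 1)).comp (LinearMap.fst k (A.X (p + 1)) (B.X p)))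
    ((h p).comp (LinearMap.fst k (A.X (p + 1)) (B.X p)) +
      (g p).comp (LinearMap.snd k (A.X (p + 1)) (B.X p)))

theorem isChain_coneMap {a : Fam A B} {b : Fam A' B'} {f : Fam A A'}
    {h : ∀ p, A.X (p + 1) →ₗ[k] B'.X p} {g : Fam B B'} (hf : IsChain f) (hg : IsChain g)
    (hh : IsHtpy (Fam.comp g a) (Fam.comp b f) h) : IsChain (coneMap a b f h g) := by
  rintro p ⟨x, y⟩
  refine Prod.ext ?_ ?_
  · change -A'.d (p + 1) (f (p + 1) x) = f (p + 1 + 1) (-A.d (p + 1) x)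
    rw [hf, map_neg]
  · change b (p + 1) (f (p + 1) x) + B'.d p (h p x + g p y) =
      h (p + 1) (-A.d (p + 1) x) + g (p + 1) (a (p + 1) x + B.d p y)
    have h1 := hh p x
    simp only [LinearMap.comp_apply] at h1
    rw [eq_sub_iff_add_eq] at h1
    rw [map_add, map_add, map_neg, ← h1, hg]
    abel

/-- An endomorphism of a cone which is homotopic to the identity on both ends is a homotopy
equivalence. -/
theorem isHE_coneMap_of_htpic_id {a : Fam A B} (hA : IsChain a) {f : Fam A A} {g : Fam B B}
    {w : ∀ p, A.X (p + 1) →ₗ[k] B.X p} (hf : IsChain f) (hg : IsChain g)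
    (hw : IsHtpy (Fam.comp g a) (Fam.comp a f) w)
    (h1 : Htpic f (idF A)) (h2 : Htpic g (idF B)) :
    IsHE (coneMap a a f w g) := by
  obtain ⟨s, hs⟩ := h1
  obtain ⟨t, ht⟩ := h2
  let w' : ∀ p, A.X (p + 1) →ₗ[k] B.X p := fun p =>
    w p - (t p).comp (a (p + 1)) + (a p).comp (s p)
  have hw' : ∀ p x, B.d p (w' p x) + w' (p + 1) (A.d (p + 1) x) = 0 := by
    intro p x
    have e1 := hw p x
    have e2 := ht p (a (p + 1) x)
    have e3 := congrArg (a (p + 1)) (hs p x)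
    simp only [LinearMap.comp_apply, LinearMap.id_apply, map_add, map_sub] at e1 e2 e3
    simp only [w', LinearMap.add_apply, LinearMap.sub_apply, LinearMap.comp_apply, map_add,
      map_sub, hA _ _] at e1 e2 e3 ⊢
    rw [← sub_eq_zero] at e1 e2 e3
    have := congrArg₂ (· + ·) (congrArg₂ (· - ·) e1 e2) e3
    simp only [sub_zero, add_zero] at this
    rw [← this]
    abel
  have c1 : IsChain (coneMap a a (idF A) w' (idF B)) :=
    isChain_coneMap (isChain_id A) (isChain_id B) fun p x => by simpa using hw' p x
  have c2 : IsChain (coneMap a a (idF A) (fun p => -w' p) (idF B)) :=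
    isChain_coneMap (isChain_id A) (isChain_id B) fun p x => by
      have := hw' p x
      rw [← neg_eq_zero, neg_add] at this
      simpa using this
  refine (IsHE.of_strict c1 c2 ?_ ?_).congr (isChain_coneMap hf hg hw) ?_
  · rintro p ⟨x, y⟩
    exact Prod.ext rfl (neg_add_cancel_left (w' p x) y)
  · rintro p ⟨x, y⟩
    exact Prod.ext rfl (add_neg_cancel_left (w' p x) y)
  · apply Htpic.symm
    refine ⟨fun p => LinearMap.prod
      ((-(s (p + 1))).comp (LinearMap.fst k (A.X (p + 1 + 1)) (B.X (p + 1))))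
      ((t p).comp (LinearMap.snd k (A.X (p + 1 + 1)) (B.X (p + 1)))), ?_⟩
    rintro p ⟨x, y⟩
    refine Prod.ext ?_ ?_
    · change -A.d (p + 1) (-s (p + 1) x) + -s (p + 1 + 1) (-A.d (p + 1 + 1) x) =
        f (p + 1 + 1) x - x
      rw [map_neg, map_neg, neg_neg, neg_neg]
      exact hs (p + 1) x
    · change a (p + 1) (-s (p + 1) x) + B.d p (t p y) +
          t (p + 1) (a (p + 1 + 1) x + B.d (p + 1) y) =
        w (p + 1) x + g (p + 1) y -
          (w (p + 1) x - t (p + 1) (a (p + 1 + 1) x) + a (p + 1) (s (p + 1) x) + y)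
      have e2 := ht p y
      rw [eq_sub_iff_add_eq] at e2
      rw [← e2, LinearMap.id_apply, map_add, map_neg]
      abel

theorem isHE_comp_coneMap {a : Fam A B} {b : Fam A' B'} {f : Fam A A'}
    {h : ∀ p, A.X (p + 1) →ₗ[k] B'.X p} {g : Fam B B'} (ha : IsChain a)
    (hf : IsChain f) (hg : IsChain g) (hh : IsHtpy (Fam.comp g a) (Fam.comp b f) h)
    {f' : Fam A' A} {g' : Fam B' B} (hf' : IsChain f') (hg' : IsChain g')
    (e1 : Htpic (Fam.comp f' f) (idF A)) (e2 : Htpic (Fam.comp g' g) (idF B))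
    (h' : ∀ p, A'.X (p + 1) →ₗ[k] B.X p) (hh' : IsHtpy (Fam.comp g' b) (Fam.comp a f') h') :
    IsHE (Fam.comp (coneMap b a f' h' g') (coneMap a b f h g)) := by
  have : Fam.comp (coneMap b a f' h' g') (coneMap a b f h g) = coneMap a a (Fam.comp f' f)
      (fun p => (h' p).comp (f (p + 1)) + (g' p).comp (h p)) (Fam.comp g' g) := by
    funext p
    refine LinearMap.ext ?_
    rintro ⟨x, y⟩
    refine Prod.ext rfl ?_
    change h' p (f (p + 1) x) + g' p (h p x + g p y) =
      h' p (f (p + 1) x) + g' p (h p x) + g' p (g p y)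
    rw [map_add, add_assoc]
  rw [this]
  refine isHE_coneMap_of_htpic_id ha (hf'.comp hf) (hg'.comp hg) ?_ e1 e2
  intro p x
  have h1 := hh' p (f (p + 1) x)
  have h2 := congrArg (g' (p + 1)) (hh p x)
  simp only [LinearMap.comp_apply, LinearMap.add_apply, map_add, map_sub, hf _ _,
    hg' _ _] at h1 h2 ⊢
  rw [add_add_add_comm, h1, h2]
  abel

/-- A map of cones which is a homotopy equivalence on both ends is a homotopy equivalence. -/
theorem isHE_coneMap {a : Fam A B} {b : Fam A' B'} {f : Fam A A'}
    {h : ∀ p, A.X (p + 1) →ₗ[k] B'.X p} {g : Fam B B'} (ha : IsChain a) (hb : IsChain b)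
    (hf : IsHE f) (hg : IsHE g) (hh : IsHtpy (Fam.comp g a) (Fam.comp b f) h) :
    IsHE (coneMap a b f h g) := by
  obtain ⟨cf, f', cf', ef, ef'⟩ := hf
  obtain ⟨cg, g', cg', eg, eg'⟩ := hg
  have hs : Htpic (Fam.comp g a) (Fam.comp b f) := ⟨h, hh⟩
  have h' : Htpic (Fam.comp g' b) (Fam.comp a f') :=
    ((ef'.comp_left (cg'.comp hb)).symm.trans ((hs.comp_right cf').comp_left cg').symm).trans
      (eg.comp_right (ha.comp cf'))
  obtain ⟨h', hh'⟩ := h'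
  have c := isChain_coneMap cf cg hh
  have c' := isChain_coneMap cf' cg' hh'
  obtain ⟨-, l, cl, l1, l2⟩ :=
    isHE_comp_coneMap ha cf cg hh cf' cg' ef eg h' hh'
  obtain ⟨-, r, cr, r1, r2⟩ :=
    isHE_comp_coneMap hb cf' cg' hh' cf cg ef' eg' h hh
  exact IsHE.of_inverse c (cl.comp c') (c'.comp cr) l1 r2

/-- Sequences of objects and degree-`0` families. -/
structure DSeq (k : Type u) [CommRing k] where
  A : ℕ → DCx k
  a : ∀ i, Fam (A i) (A (i + 1))

/-- The composite `aᵢ ∘ ⋯ ∘ a₀`. -/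
def DSeq.abar (S : DSeq k) : ∀ i, Fam (S.A 0) (S.A (i + 1))
  | 0 => S.a 0
  | i + 1 => Fam.comp (S.a (i + 1)) (DSeq.abar S i)

/-- The structure maps up to index `m` are chain maps. -/
def DSeq.Valid (m : ℕ) (S : DSeq k) : Prop := ∀ i ≤ m, IsChain (S.a i)

theorem DSeq.Valid.abar {m : ℕ} {S : DSeq k} (hS : S.Valid m) : ∀ i ≤ m, IsChain (S.abar i)
  | 0, h => hS 0 h
  | i + 1, h => (hS (i + 1) h).comp (DSeq.Valid.abar hS i (by omega))

/-- Homotopy equivalence of sequences on the window `0, …, m + 1`. -/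
def DSeq.Equiv (m : ℕ) (S T : DSeq k) : Prop :=
  ∃ φ : ∀ i, Fam (S.A i) (T.A i), (∀ i ≤ m + 1, IsHE (φ i)) ∧
    ∀ i ≤ m, Htpic (Fam.comp (φ (i + 1)) (S.a i)) (Fam.comp (T.a i) (φ i))

theorem DSeq.Equiv.trans {m : ℕ} {S T U : DSeq k} :
    S.Equiv m T → T.Equiv m U → S.Equiv m U := by
  rintro ⟨φ, hφ, e⟩ ⟨ψ, hψ, e'⟩
  refine ⟨fun i => Fam.comp (ψ i) (φ i), fun i hi => (hψ i hi).comp (hφ i hi), fun i hi => ?_⟩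
  exact ((e i hi).comp_left (hψ (i + 1) (by omega)).1).trans
    ((e' i hi).comp_right (hφ i (by omega)).1)

/-- `T` is a model of the Coxeter transform of `S`, up to homotopy equivalence. -/
structure DSeq.IsCoxeter (m : ℕ) (S T : DSeq k) where
  θ : ∀ i, Fam (cone (S.abar i)) (T.A i)
  l : ∀ i, Fam (shift (S.A 0)) (T.A i)
  isHE_θ : ∀ i ≤ m, IsHE (θ i)
  isHE_l : IsHE (l (m + 1))
  comm : ∀ i < m, Htpic
    (Fam.comp (θ (i + 1)) (coneMap (S.abar i) (S.abar (i + 1)) (idF (S.A 0)) 0 (S.a (i + 1))))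
    (Fam.comp (T.a i) (θ i))
  comm_last : Htpic (Fam.comp (l (m + 1)) (coneFst (S.abar m))) (Fam.comp (T.a m) (θ m))

theorem DSeq.IsCoxeter.nonempty_of_abar_eq {m : ℕ} {S T : DSeq k}
    (b : ∀ i, Fam (S.A 0) (S.A (i + 1))) (hb : S.abar = b)
    (θ : ∀ i, Fam (cone (b i)) (T.A i)) (l : ∀ i, Fam (shift (S.A 0)) (T.A i))
    (isHE_θ : ∀ i ≤ m, IsHE (θ i)) (isHE_l : IsHE (l (m + 1)))
    (comm : ∀ i < m, Htpic
      (Fam.comp (θ (i + 1)) (coneMap (b i) (b (i + 1)) (idF (S.A 0)) 0 (S.a (i + 1))))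
      (Fam.comp (T.a i) (θ i)))
    (comm_last : Htpic (Fam.comp (l (m + 1)) (coneFst (b m))) (Fam.comp (T.a m) (θ m))) :
    Nonempty (S.IsCoxeter m T) := by
  subst hb
  exact ⟨⟨θ, l, isHE_θ, isHE_l, comm, comm_last⟩⟩

theorem Htpic.inv_square {f : Fam A B} {f' : Fam A' B'} {a : Fam A A'} {b : Fam B B'}
    (hb : IsChain b) (e : Htpic (Fam.comp f' a) (Fam.comp b f)) {g : Fam B A} {g' : Fam B' A'}
    (ha : IsChain a) (hg : IsChain g) (hg' : IsChain g')
    (h : Htpic (Fam.comp f g) (idF B)) (h' : Htpic (Fam.comp g' f') (idF A')) :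
    Htpic (Fam.comp g' b) (Fam.comp a g) :=
  ((h.comp_left (hg'.comp hb)).symm.trans ((e.comp_right hg).comp_left hg').symm).trans
    (h'.comp_right (ha.comp hg))

theorem isChain_coneMap_diag {a : Fam A B} {b : Fam A' B'} {f : Fam A A'} {g : Fam B B'}
    (hf : IsChain f) (hg : IsChain g) (h : ∀ p x, g p (a p x) = b p (f p x)) :
    IsChain (coneMap a b f 0 g) :=
  isChain_coneMap hf hg fun p x => by simp [h]

/-- Homotopy equivalent sequences have homotopy equivalent Coxeter transforms. -/
theorem DSeq.Equiv.coxeter {m : ℕ} {S S' T T' : DSeq k} (hS : S.Valid m) (hS' : S'.Valid m)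
    (hT : T.Valid m) (c : S.IsCoxeter m T) (c' : S'.IsCoxeter m T')
    (E : S.Equiv m S') : T.Equiv m T' := by
  obtain ⟨φ, hφ, e⟩ := E
  have e : ∀ i, ∃ s, i ≤ m → IsHtpy (Fam.comp (φ (i + 1)) (S.a i)) (Fam.comp (S'.a i) (φ i)) s := by
    intro i
    by_cases hi : i ≤ m
    · obtain ⟨s, hs⟩ := e i hi
      exact ⟨s, fun _ => hs⟩
    · exact ⟨0, fun h => absurd h hi⟩
  choose h hh using e
  let H : ∀ i, ∀ p, (S.A 0).X (p + 1) →ₗ[k] (S'.A (i + 1)).X p := fun i =>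
    Nat.rec (h 0) (fun i Hi p => (S'.a (i + 1) p).comp (Hi p) +
      (h (i + 1) p).comp (S.abar i (p + 1))) i
  have hH : ∀ i ≤ m, IsHtpy (Fam.comp (φ (i + 1)) (S.abar i))
      (Fam.comp (S'.abar i) (φ 0)) (H i) := by
    intro i
    induction i with
    | zero => exact hh 0
    | succ i ih =>
      intro hi p x
      have h1 := congrArg (S'.a (i + 1) (p + 1)) (ih (by omega) p x)
      have h2 := hh (i + 1) hi p (S.abar i (p + 1) x)
      change (S'.A (i + 1 + 1)).d p (S'.a (i + 1) p (H i p x) + h (i + 1) p (S.abar i (p + 1) x)) +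
        (S'.a (i + 1) (p + 1) (H i (p + 1) ((S.A 0).d (p + 1) x)) +
          h (i + 1) (p + 1) (S.abar i (p + 1 + 1) ((S.A 0).d (p + 1) x))) =
        φ (i + 1 + 1) (p + 1) (S.a (i + 1) (p + 1) (S.abar i (p + 1) x)) -
          S'.a (i + 1) (p + 1) (S'.abar i (p + 1) (φ 0 (p + 1) x))
      simp only [LinearMap.comp_apply, map_add, map_sub] at h1 h2
      rw [map_add, hS' (i + 1) hi, ← hS.abar i (by omega), add_add_add_comm, h1, h2]
      abel
  let F : ∀ i, Fam (cone (S.abar i)) (cone (S'.abar i)) := fun i =>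
    coneMap (S.abar i) (S'.abar i) (φ 0) (H i) (φ (i + 1))
  have hF : ∀ i ≤ m, IsHE (F i) := fun i hi =>
    isHE_coneMap (hS.abar i hi) (hS'.abar i hi) (hφ 0 (by omega)) (hφ (i + 1) (by omega)) (hH i hi)
  let δ : ∀ i, Fam (cone (S.abar i)) (cone (S.abar (i + 1))) := fun i =>
    coneMap (S.abar i) (S.abar (i + 1)) (idF (S.A 0)) 0 (S.a (i + 1))
  let δ' : ∀ i, Fam (cone (S'.abar i)) (cone (S'.abar (i + 1))) := fun i =>
    coneMap (S'.abar i) (S'.abar (i + 1)) (idF (S'.A 0)) 0 (S'.a (i + 1))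
  have hδ : ∀ i < m, IsChain (δ i) := fun i hi =>
    isChain_coneMap_diag (isChain_id _) (hS (i + 1) hi) fun _ _ => rfl
  have hFδ : ∀ i < m, Htpic (Fam.comp (F (i + 1)) (δ i)) (Fam.comp (δ' i) (F i)) := by
    intro i hi
    refine ⟨fun p => LinearMap.prod 0
      ((h (i + 1) p).comp (LinearMap.snd k ((S.A 0).X (p + 1 + 1)) ((S.A (i + 1)).X (p + 1)))), ?_⟩
    rintro p ⟨x, y⟩
    refine Prod.ext ?_ ?_
    · change -(S'.A 0).d (p + 1) 0 + 0 = φ 0 (p + 1 + 1) x - φ 0 (p + 1 + 1) x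
      simp
    · change S'.abar (i + 1) (p + 1) 0 + (S'.A (i + 1 + 1)).d p (h (i + 1) p y) +
          h (i + 1) (p + 1) (S.abar i (p + 1 + 1) x + (S.A (i + 1)).d (p + 1) y) =
        S'.a (i + 1) (p + 1) (H i (p + 1) x) + h (i + 1) (p + 1) (S.abar i (p + 1 + 1) x) +
          φ (i + 1 + 1) (p + 1) (0 + S.a (i + 1) (p + 1) y) -
        (0 + S'.a (i + 1) (p + 1) (H i (p + 1) x + φ (i + 1) (p + 1) y))
      have h2 := hh (i + 1) hi p y
      simp only [LinearMap.comp_apply] at h2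
      rw [eq_sub_iff_add_eq] at h2
      rw [zero_add, ← h2, map_zero, map_add, map_add]
      abel
  have inv : ∀ i, ∃ g : Fam (T.A i) (cone (S.abar i)), i ≤ m → IsHE g ∧
      Htpic (Fam.comp g (c.θ i)) (idF _) ∧ Htpic (Fam.comp (c.θ i) g) (idF _) := by
    intro i
    by_cases hi : i ≤ m
    · obtain ⟨cθ, g, cg, h1, h2⟩ := c.isHE_θ i hi
      exact ⟨g, fun _ => ⟨⟨cg, _, cθ, h2, h1⟩, h1, h2⟩⟩
    · exact ⟨0, fun h => absurd h hi⟩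
  choose g hg using inv
  have invl : ∀ i, ∃ g : Fam (T.A i) (shift (S.A 0)), i = m + 1 → IsHE g ∧
      Htpic (Fam.comp g (c.l i)) (idF _) ∧ Htpic (Fam.comp (c.l i) g) (idF _) := by
    intro i
    by_cases hi : i = m + 1
    · subst hi
      obtain ⟨cθ, g, cg, h1, h2⟩ := c.isHE_l
      exact ⟨g, fun _ => ⟨⟨cg, _, cθ, h2, h1⟩, h1, h2⟩⟩
    · exact ⟨0, fun h => absurd h hi⟩
  choose r hr using invl
  let Φ : ∀ i, Fam (T.A i) (T'.A i) := fun i =>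
    if i ≤ m then Fam.comp (c'.θ i) (Fam.comp (F i) (g i))
    else Fam.comp (c'.l i) (Fam.comp (shiftF (φ 0)) (r i))
  have Φ1 : ∀ i ≤ m, Φ i = Fam.comp (c'.θ i) (Fam.comp (F i) (g i)) := fun i hi => if_pos hi
  have Φ2 : Φ (m + 1) = Fam.comp (c'.l (m + 1)) (Fam.comp (shiftF (φ 0)) (r (m + 1))) :=
    if_neg (by omega)
  have cθ := fun i hi => (c.isHE_θ i hi).1
  have cθ' := fun i hi => (c'.isHE_θ i hi).1
  refine ⟨Φ, fun i hi => ?_, fun i hi => ?_⟩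
  · obtain hi | rfl := Nat.le_succ_iff.mp hi
    · rw [Φ1 i hi]
      exact (c'.isHE_θ i hi).comp ((hF i hi).comp (hg i hi).1)
    · rw [Φ2]
      exact c'.isHE_l.comp ((hφ 0 (by omega)).shiftF.comp (hr _ rfl).1)
  · obtain hi' | rfl := Nat.lt_or_eq_of_le hi
    · rw [Φ1 i hi, Φ1 (i + 1) hi']
      have s1 : Htpic (Fam.comp (g (i + 1)) (T.a i)) (Fam.comp (δ i) (g i)) :=
        Htpic.inv_square (hT i hi) (c.comm i hi') (hδ i hi') (hg i hi).1.1 (hg (i + 1) hi').1.1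
          (hg i hi).2.2 (hg (i + 1) hi').2.1
      have s2 := s1.comp_left ((cθ' (i + 1) hi').comp (hF (i + 1) hi').1)
      have s3 := ((hFδ i hi').comp_right (hg i hi).1.1).comp_left (cθ' (i + 1) hi')
      have s4 := (c'.comm i hi').comp_right ((hF i hi).1.comp (hg i hi).1.1)
      exact (s2.trans s3).trans s4
    · rw [Φ1 i hi, Φ2]
      have s1 : Htpic (Fam.comp (r (i + 1)) (T.a i)) (Fam.comp (coneFst (S.abar i)) (g i)) :=
        Htpic.inv_square (hT i hi) c.comm_last (isChain_coneFst _) (hg i hi).1.1 (hr _ rfl).1.1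
          (hg i hi).2.2 (hr _ rfl).2.1
      exact (s1.comp_left (c'.isHE_l.1.comp (hφ 0 (by omega)).1.shiftF)).trans
        (c'.comm_last.comp_right ((hF i hi).1.comp (hg i hi).1.1))

/-- A functor from the poset `ℕ` to complexes that vanishes at `0` and from `n` onwards. -/
structure Persistence (k : Type u) [CommRing k] (n : ℕ) where
  U : ℕ → DCx k
  u : ∀ i j, Fam (U i) (U j)
  isCplx : ∀ i, IsCplx (U i)
  isChain : ∀ i j, IsChain (u i j)
  u_self : ∀ i p x, u i i p x = x
  u_u : ∀ {i j l}, i ≤ j → j ≤ l → ∀ p x, u j l p (u i j p x) = u i l p x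
  eq_zero_of_eq : ∀ {i}, i = 0 → ∀ p (x : (U i).X p), x = 0
  eq_zero_of_le : ∀ {i}, n ≤ i → ∀ p (x : (U i).X p), x = 0

namespace Persistence

variable {n : ℕ} (P : Persistence k n)

/-- For `j < l < n` this is the cone of `U j → U l`, and for `l = n + i` with `i ≤ j` the shifted
cone of `U i → U j`: the entries of the Auslander–Reiten quiver of type `A`. -/
def obj (j l : ℕ) : DCx k where
  X p := (P.U j).X (p + 1) × (P.U l).X p × (P.U (l - n)).X (p + 1 + 1)
  d p := LinearMap.prod
    ((-(P.U j).d (p + 1)).comp (LinearMap.fst k _ _) +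
      (P.u (l - n) j (p + 1 + 1)).comp ((LinearMap.snd k _ _).comp (LinearMap.snd k _ _)))
    (LinearMap.prod
      ((P.u j l (p + 1)).comp (LinearMap.fst k _ _) +
        ((P.U l).d p).comp ((LinearMap.fst k _ _).comp (LinearMap.snd k _ _)))
      (((P.U (l - n)).d (p + 1 + 1)).comp ((LinearMap.snd k _ _).comp (LinearMap.snd k _ _))))

/-- The horizontal maps between the entries. -/
def map (j l l' : ℕ) : Fam (P.obj j l) (P.obj j l') := fun p =>
  LinearMap.prodMap LinearMap.id
    (LinearMap.prodMap (P.u l l' p) (P.u (l - n) (l' - n) (p + 1 + 1)))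

/-- The `j`-th row. -/
def row (j : ℕ) : DSeq k where
  A i := P.obj j (j + 1 + i)
  a i := P.map j (j + 1 + i) (j + 1 + (i + 1))

theorem isChain_map {j l l' : ℕ} (h : j ≤ l) (h' : l ≤ l') (hn : l' ≤ j + n) :
    IsChain (P.map j l l') := by
  rintro p ⟨x, y, z⟩
  refine Prod.ext ?_ (Prod.ext ?_ ?_)
  · change -(P.U j).d (p + 1) x + P.u (l' - n) j (p + 1 + 1) (P.u (l - n) (l' - n) (p + 1 + 1) z) =
      -(P.U j).d (p + 1) x + P.u (l - n) j (p + 1 + 1) z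
    rw [P.u_u (by omega) (by omega)]
  · change P.u j l' (p + 1) x + (P.U l').d p (P.u l l' p y) =
      P.u l l' (p + 1) (P.u j l (p + 1) x + (P.U l).d p y)
    rw [map_add, P.u_u h h', P.isChain]
  · exact P.isChain _ _ _ _

theorem valid_row {m j : ℕ} (hn : n = m + 3) : (P.row j).Valid m := fun i hi =>
  P.isChain_map (by omega) (by omega) (by omega)

theorem abar_row (j : ℕ) : ∀ i, (P.row j).abar i = P.map j (j + 1) (j + 1 + (i + 1))
  | 0 => rfl
  | i + 1 => by
    funext p
    refine LinearMap.ext ?_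
    rintro ⟨x, y, z⟩
    rw [DSeq.abar, abar_row j i]
    exact Prod.ext rfl (Prod.ext (P.u_u (by omega) (by omega) _ _)
      (P.u_u (by omega) (by omega) _ _))

/-- The comparison from the cone to the next row. -/
def next (j l l' : ℕ) : Fam (cone (P.map j (j + 1) l)) (P.obj (j + 1) l') := fun p =>
  LinearMap.prod
    ((P.u j (j + 1) (p + 1)).comp ((LinearMap.fst k _ _).comp
        (LinearMap.snd k ((P.obj j (j + 1)).X (p + 1)) ((P.obj j l).X p))) +
      ((LinearMap.fst k _ _).comp (LinearMap.snd k _ _)).comp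
        (LinearMap.fst k ((P.obj j (j + 1)).X (p + 1)) ((P.obj j l).X p)))
    ((LinearMap.prodMap (P.u l l' p) (P.u (l - n) (l' - n) (p + 1 + 1))).comp
      ((LinearMap.snd k _ _).comp
        (LinearMap.snd k ((P.obj j (j + 1)).X (p + 1)) ((P.obj j l).X p))))

/-- The homotopy inverse of `next`. -/
def nextInv (j l : ℕ) : Fam (P.obj (j + 1) l) (cone (P.map j (j + 1) l)) := fun p =>
  LinearMap.prod
    (LinearMap.prod
      (-(P.u (l - n) j (p + 1 + 1)).comp ((LinearMap.snd k _ _).comp (LinearMap.snd k _ _)))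
      (LinearMap.prod (LinearMap.fst k _ _) 0))
    (LinearMap.prod 0 (LinearMap.snd k _ _))

theorem isChain_next {j l : ℕ} (hj : j + 1 ≤ n) (hl : j + 1 ≤ l) (hn : l ≤ j + n) :
    IsChain (P.next j l l) := by
  rintro p ⟨⟨x, y, w⟩, x', z, v⟩
  have hw : w = 0 := P.eq_zero_of_eq (by omega) _ _
  subst hw
  refine Prod.ext ?_ (Prod.ext ?_ ?_)
  · change -(P.U (j + 1)).d (p + 1) (P.u j (j + 1) (p + 1) x' + y) +
        P.u (l - n) (j + 1) (p + 1 + 1) (P.u (l - n) (l - n) (p + 1 + 1) v) =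
      P.u j (j + 1) (p + 1 + 1) (x + (-(P.U j).d (p + 1) x' + P.u (l - n) j (p + 1 + 1) v)) +
        -(P.u j (j + 1) (p + 1 + 1) x + (P.U (j + 1)).d (p + 1) y)
    simp only [P.u_self, map_add, map_neg, P.isChain _ _ _ _]
    rw [P.u_u (by omega) (by omega)]
    abel
  · change P.u (j + 1) l (p + 1) (P.u j (j + 1) (p + 1) x' + y) + (P.U l).d p (P.u l l p z) =
      P.u l l (p + 1) (P.u (j + 1) l (p + 1) y + (P.u j l (p + 1) x' + (P.U l).d p z))
    simp only [P.u_self, map_add]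
    rw [P.u_u (by omega) (by omega)]
    abel
  · change (P.U (l - n)).d (p + 1 + 1) (P.u (l - n) (l - n) (p + 1 + 1) v) =
      P.u (l - n) (l - n) (p + 1 + 1 + 1)
        (P.u (j + 1 - n) (l - n) (p + 1 + 1 + 1) 0 + (P.U (l - n)).d (p + 1 + 1) v)
    simp only [P.u_self, map_zero, zero_add]

theorem isChain_nextInv {j l : ℕ} (hn : l ≤ j + n) :
    IsChain (P.nextInv j l) := by
  rintro p ⟨y, z, v⟩
  refine Prod.ext (Prod.ext ?_ (Prod.ext ?_ ?_)) (Prod.ext ?_ (Prod.ext ?_ ?_))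
  · change -(-(P.U j).d (p + 1 + 1) (-P.u (l - n) j (p + 1 + 1) v) +
        P.u (j + 1 - n) j (p + 1 + 1 + 1) 0) =
      -P.u (l - n) j (p + 1 + 1 + 1) ((P.U (l - n)).d (p + 1 + 1) v)
    simp only [map_neg, P.isChain _ _ _ _, map_zero, neg_neg, add_zero]
  · change -(P.u j (j + 1) (p + 1 + 1) (-P.u (l - n) j (p + 1 + 1) v) + (P.U (j + 1)).d (p + 1) y) =
      -(P.U (j + 1)).d (p + 1) y + P.u (l - n) (j + 1) (p + 1 + 1) v
    rw [map_neg, P.u_u (by omega) (by omega)]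
    abel
  · change -(P.U (j + 1 - n)).d (p + 1 + 1 + 1) 0 = 0
    simp
  · change -P.u (l - n) j (p + 1 + 1) v +
      (-(P.U j).d (p + 1) 0 + P.u (l - n) j (p + 1 + 1) v) = 0
    simp
  · change P.u (j + 1) l (p + 1) y + (P.u j l (p + 1) 0 + (P.U l).d p z) =
      P.u (j + 1) l (p + 1) y + (P.U l).d p z
    simp
  · change P.u (j + 1 - n) (l - n) (p + 1 + 1 + 1) 0 + (P.U (l - n)).d (p + 1 + 1) v =
      (P.U (l - n)).d (p + 1 + 1) v
    simp

theorem isHE_next {j l l' : ℕ} (hj : j + 1 ≤ n) (hl : j + 1 ≤ l) (hn : l ≤ j + n) (h : l' = l) :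
    IsHE (P.next j l l') := by
  subst h
  refine ⟨P.isChain_next hj hl hn, P.nextInv j l', P.isChain_nextInv hn, ?_, .of_eq ?_⟩
  · refine ⟨fun p => LinearMap.prod
      (LinearMap.prod (-((LinearMap.fst k _ _).comp (LinearMap.snd k _ _))) 0) 0, ?_⟩
    rintro p ⟨⟨x, y, w⟩, x', z, v⟩
    have hw : w = 0 := P.eq_zero_of_eq (by omega) _ _
    subst hw
    refine Prod.ext (Prod.ext ?_ (Prod.ext ?_ ?_)) (Prod.ext ?_ (Prod.ext ?_ ?_))
    · change -(-(P.U j).d (p + 1 + 1) (-x') + P.u (j + 1 - n) j (p + 1 + 1 + 1) 0) +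
        -(x + (-(P.U j).d (p + 1 + 1) x' + P.u (l' - n) j (p + 1 + 1 + 1) v)) =
        -P.u (l' - n) j (p + 1 + 1 + 1) (P.u (l' - n) (l' - n) (p + 1 + 1 + 1) v) - x
      simp only [P.u_self, map_neg, map_zero]
      abel
    · change -(P.u j (j + 1) (p + 1 + 1) (-x') + (P.U (j + 1)).d (p + 1) 0) + 0 =
        P.u j (j + 1) (p + 1 + 1) x' + y - y
      simp
    · change -(P.U (j + 1 - n)).d (p + 1 + 1 + 1) 0 + 0 = 0 - 0
      simp
    · change -x' + (-(P.U j).d (p + 1) 0 + P.u (l' - n) j (p + 1 + 1) 0) + 0 = 0 - x'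
      simp
    · change P.u (j + 1) l' (p + 1) 0 + (P.u j l' (p + 1) 0 + (P.U l').d p 0) + 0 =
        P.u l' l' (p + 1) z - z
      simp [P.u_self]
    · change P.u (j + 1 - n) (l' - n) (p + 1 + 1 + 1) 0 + (P.U (l' - n)).d (p + 1 + 1) 0 + 0 =
        P.u (l' - n) (l' - n) (p + 1 + 1 + 1) v - v
      simp [P.u_self]
  · rintro p ⟨y, z, v⟩
    refine Prod.ext ?_ (Prod.ext ?_ ?_)
    · change P.u j (j + 1) (p + 1) 0 + y = y
      simp
    · exact P.u_self _ _ _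
    · exact P.u_self _ _ _

/-- The comparison from the shift of the first entry to the last entry of the next row. -/
def last (j l : ℕ) : Fam (shift (P.obj j (j + 1))) (P.obj (j + 1) l) := fun p =>
  LinearMap.prod ((LinearMap.fst k _ _).comp (LinearMap.snd k _ _))
    (LinearMap.prod 0 (-(P.u j (l - n) (p + 1 + 1)).comp (LinearMap.fst k _ _)))

/-- The inverse of `last`. -/
def lastInv (j l : ℕ) : Fam (P.obj (j + 1) l) (shift (P.obj j (j + 1))) := fun p =>
  LinearMap.prod
    (-(P.u (l - n) j (p + 1 + 1)).comp ((LinearMap.snd k _ _).comp (LinearMap.snd k _ _)))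
    (LinearMap.prod (LinearMap.fst k _ _) 0)

theorem isHE_last {j l : ℕ} (hj : j + 1 ≤ n) (hl : l = j + n) : IsHE (P.last j l) := by
  have zl : ∀ p (x : (P.U l).X p), x = 0 := P.eq_zero_of_le (by omega)
  have z0 : ∀ p (x : (P.U (j + 1 - n)).X p), x = 0 := P.eq_zero_of_eq (by omega)
  refine IsHE.of_strict (g := P.lastInv j l) ?_ ?_ ?_ ?_
  · rintro p ⟨x, y, w⟩
    obtain rfl := z0 _ w
    refine Prod.ext ?_ (Prod.ext ((zl _ _).trans (zl _ _).symm) ?_)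
    · change -(P.U (j + 1)).d (p + 1) y +
          P.u (l - n) (j + 1) (p + 1 + 1) (-P.u j (l - n) (p + 1 + 1) x) =
        -(P.u j (j + 1) (p + 1 + 1) x + (P.U (j + 1)).d (p + 1) y)
      rw [map_neg, P.u_u (by omega) (by omega)]
      abel
    · change (P.U (l - n)).d (p + 1 + 1) (-P.u j (l - n) (p + 1 + 1) x) =
        -P.u j (l - n) (p + 1 + 1 + 1)
          (-(-(P.U j).d (p + 1 + 1) x + P.u (j + 1 - n) j (p + 1 + 1 + 1) 0))
      simp only [map_neg, P.isChain _ _ _ _, map_zero, neg_neg, add_zero]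
  · rintro p ⟨y, z, v⟩
    refine Prod.ext ?_ (Prod.ext ?_ ((z0 _ _).trans (z0 _ _).symm))
    · change -(-(P.U j).d (p + 1 + 1) (-P.u (l - n) j (p + 1 + 1) v) +
          P.u (j + 1 - n) j (p + 1 + 1 + 1) 0) =
        -P.u (l - n) j (p + 1 + 1 + 1) ((P.U (l - n)).d (p + 1 + 1) v)
      simp only [map_neg, P.isChain _ _ _ _, map_zero, neg_neg, add_zero]
    · change -(P.u j (j + 1) (p + 1 + 1) (-P.u (l - n) j (p + 1 + 1) v) +
          (P.U (j + 1)).d (p + 1) y) =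
        -(P.U (j + 1)).d (p + 1) y + P.u (l - n) (j + 1) (p + 1 + 1) v
      rw [map_neg, P.u_u (by omega) (by omega)]
      abel
  · rintro p ⟨x, y, w⟩
    refine Prod.ext ?_ (Prod.ext rfl ((z0 _ _).trans (z0 _ _).symm))
    change -P.u (l - n) j (p + 1 + 1) (-P.u j (l - n) (p + 1 + 1) x) = x
    rw [map_neg, neg_neg, P.u_u (by omega) (by omega), P.u_self]
  · rintro p ⟨y, z, v⟩
    refine Prod.ext rfl (Prod.ext ((zl _ _).trans (zl _ _).symm) ?_)
    change -P.u j (l - n) (p + 1 + 1) (-P.u (l - n) j (p + 1 + 1) v) = v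
    rw [map_neg, neg_neg, P.u_u (by omega) (by omega), P.u_self]

theorem next_comp_coneMap (j : ℕ) {l l₁ l' l₁' : ℕ} (hl : l ≤ l₁) (h : l' = l) (h₁ : l₁' = l₁)
    (p : ℤ) (x : (cone (P.map j (j + 1) l)).X p) :
    P.next j l₁ l₁' p (coneMap (P.map j (j + 1) l) (P.map j (j + 1) l₁) (idF _) 0
      (P.map j l l₁) p x) = P.map (j + 1) l' l₁' p (P.next j l l' p x) := by
  subst h h₁
  obtain ⟨⟨x, y, w⟩, x', z, v⟩ := x
  refine Prod.ext ?_ (Prod.ext ?_ ?_)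
  · change P.u j (j + 1) (p + 1) (0 + x') + y = P.u j (j + 1) (p + 1) x' + y
    rw [zero_add]
  · change P.u l₁' l₁' p (0 + P.u l' l₁' p z) = P.u l' l₁' p (P.u l' l' p z)
    rw [zero_add, P.u_self, P.u_self]
  · change P.u (l₁' - n) (l₁' - n) _ (0 + P.u (l' - n) (l₁' - n) _ v) =
      P.u (l' - n) (l₁' - n) _ (P.u (l' - n) (l' - n) _ v)
    rw [zero_add, P.u_self, P.u_self]

theorem htpic_last_next (j : ℕ) {l l' l₁ : ℕ} (hl : j + 1 ≤ l) (h : l' = l)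
    (h₁ : l + 1 = l₁) (hn : l₁ = j + n) :
    Htpic (Fam.comp (P.last j l₁) (coneFst (P.map j (j + 1) l)))
      (Fam.comp (P.map (j + 1) l' l₁) (P.next j l l')) := by
  subst h
  have zl : ∀ p (x : (P.U l₁).X p), x = 0 := P.eq_zero_of_le (by omega)
  apply Htpic.symm
  refine ⟨fun p => LinearMap.prod 0 (LinearMap.prod 0
    ((P.u j (l₁ - n) (p + 1 + 1)).comp
      ((LinearMap.fst k ((P.U j).X (p + 1 + 1))
        ((P.U l').X (p + 1) × (P.U (l' - n)).X (p + 1 + 1 + 1))).comp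
        (LinearMap.snd k ((P.obj j (j + 1)).X (p + 1 + 1)) ((P.obj j l').X (p + 1)))))), ?_⟩
  rintro p ⟨⟨x, y, w⟩, x', z, v⟩
  refine Prod.ext ?_ (Prod.ext ((zl _ _).trans (zl _ _).symm) ?_)
  · change -(P.U (j + 1)).d (p + 1) 0 +
        P.u (l₁ - n) (j + 1) (p + 1 + 1) (P.u j (l₁ - n) (p + 1 + 1) x') + 0 =
      P.u j (j + 1) (p + 1 + 1) x' + y - y
    rw [P.u_u (by omega) (by omega)]
    simp
  · change (P.U (l₁ - n)).d (p + 1 + 1) (P.u j (l₁ - n) (p + 1 + 1) x') +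
        P.u j (l₁ - n) (p + 1 + 1 + 1)
          (x + (-(P.U j).d (p + 1 + 1) x' + P.u (l' - n) j (p + 1 + 1 + 1) v)) =
      P.u (l' - n) (l₁ - n) (p + 1 + 1 + 1) (P.u (l' - n) (l' - n) (p + 1 + 1 + 1) v) -
        -P.u j (l₁ - n) (p + 1 + 1 + 1) x
    simp only [map_add, map_neg, P.isChain _ _ _ _, P.u_self]
    rw [P.u_u (by omega) (by omega)]
    abel

/-- Each row is a model of the Coxeter transform of the previous one. -/
theorem nonempty_isCoxeter_row {m j : ℕ} (hn : n = m + 3) (hj : j + 1 ≤ n) :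
    Nonempty ((P.row j).IsCoxeter m (P.row (j + 1))) := by
  have e : ∀ i, j + 1 + 1 + i = j + 1 + (i + 1) := fun i => by omega
  refine DSeq.IsCoxeter.nonempty_of_abar_eq _ (funext (P.abar_row j))
    (fun i => P.next j (j + 1 + (i + 1)) (j + 1 + 1 + i)) (fun i => P.last j (j + 1 + 1 + i))
    (fun i hi => ?_) (P.isHE_last hj (by omega)) (fun i _ => .of_eq fun p x => ?_)
    (P.htpic_last_next j (by omega) (e m) (by omega) (by omega))
  · exact P.isHE_next hj (by omega) (by omega) (e i)
  · exact P.next_comp_coneMap j (by omega) (e i) (e (i + 1)) p x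

end Persistence

/-- The zero object. -/
def zero (k : Type u) [CommRing k] : DCx k where
  X _ := PUnit
  d _ := 0

/-- `A` if `b` holds, and zero otherwise. -/
def gate : Bool → DCx k → DCx k
  | true, A => A
  | false, _ => zero k

/-- The canonical map to the gated object. -/
def gateIn : ∀ (b : Bool) (A : DCx k), Fam A (gate b A)
  | true, A => idF A
  | false, _ => 0

/-- The canonical map from the gated object. -/
def gateOut : ∀ (b : Bool) (A : DCx k), Fam (gate b A) A
  | true, A => idF A
  | false, _ => 0

theorem isCplx_gate {b : Bool} {A : DCx k} (h : b = true → IsCplx A) : IsCplx (gate b A) := by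
  cases b
  · exact fun _ _ => rfl
  · exact h rfl

theorem isChain_gate {A B : DCx k} {b c : Bool} {f : Fam A B}
    (h : b = true → c = true → IsChain f) :
    IsChain (Fam.comp (gateIn c B) (Fam.comp f (gateOut b A))) := by
  cases c
  · exact fun _ _ => rfl
  · cases b
    · intro p x
      change B.d p (f p 0) = f (p + 1) 0
      simp
    · exact h rfl rfl

/-- The truncation of a sequence to its window `0, …, m + 1`, moved up by one position. -/
def DSeq.trunc (m : ℕ) (S : DSeq k) : DSeq k where
  A
    | 0 => zero k
    | i + 1 => gate (decide (i ≤ m + 1)) (S.A i)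
  a
    | 0 => 0
    | i + 1 => Fam.comp (gateIn _ _) (Fam.comp (S.a i) (gateOut _ _))

/-- The composite of the structure maps from the `i`-th to the `j`-th object. -/
def DSeq.hom (V : DSeq k) (i : ℕ) : ∀ j, Fam (V.A i) (V.A j)
  | 0 => if h : i = 0 then h ▸ idF (V.A i) else 0
  | j + 1 => if h : i = j + 1 then h ▸ idF (V.A i) else Fam.comp (V.a j) (V.hom i j)

theorem DSeq.hom_self (V : DSeq k) (i : ℕ) : V.hom i i = idF (V.A i) := by
  cases i <;> exact dif_pos rfl

theorem DSeq.hom_succ (V : DSeq k) {i j : ℕ} (h : i ≤ j) :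
    V.hom i (j + 1) = Fam.comp (V.a j) (V.hom i j) := dif_neg (by omega)

theorem DSeq.hom_hom (V : DSeq k) {i j l : ℕ} (hij : i ≤ j) (hjl : j ≤ l) (p : ℤ)
    (x : (V.A i).X p) : V.hom j l p (V.hom i j p x) = V.hom i l p x := by
  induction l, hjl using Nat.le_induction with
  | base => rw [hom_self, LinearMap.id_apply]
  | succ l hl ih =>
    rw [hom_succ V hl, hom_succ V (hij.trans hl)]
    exact congrArg (V.a l p) ih

theorem isChain_zero (A B : DCx k) : IsChain (0 : Fam A B) := fun p x => by simp

theorem DSeq.isChain_hom (V : DSeq k) (h : ∀ i, IsChain (V.a i)) (i j : ℕ) :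
    IsChain (V.hom i j) := by
  induction j with
  | zero =>
    rw [hom]
    split_ifs with e
    · subst e
      exact isChain_id _
    · exact isChain_zero _ _
  | succ j ih =>
    rw [hom]
    split_ifs with e
    · subst e
      exact isChain_id _
    · exact (h j).comp ih

/-- The persistence object of a sequence. -/
def DSeq.persistence {m : ℕ} {S : DSeq k} (hA : ∀ i ≤ m + 1, IsCplx (S.A i)) (hS : S.Valid m) :
    Persistence k (m + 3) where
  U := (S.trunc m).A
  u := (S.trunc m).hom
  isCplx
    | 0 => fun _ _ => rfl
    | i + 1 => isCplx_gate fun h => hA i (of_decide_eq_true h)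
  isChain := (S.trunc m).isChain_hom fun
    | 0 => fun _ _ => map_zero _
    | i + 1 => isChain_gate fun _ h => hS i (by have := of_decide_eq_true h; omega)
  u_self i p x := by rw [hom_self, LinearMap.id_apply]
  u_u hij hjl p x := (S.trunc m).hom_hom hij hjl p x
  eq_zero_of_eq := by
    rintro _ rfl p x
    rfl
  eq_zero_of_le := by
    intro i hi p x
    obtain ⟨i, rfl⟩ := Nat.exists_eq_succ_of_ne_zero (by omega : i ≠ 0)
    have h : decide (i ≤ m + 1) = false := decide_eq_false (by omega)
    change (gate (decide (i ≤ m + 1)) (S.A i)).X p at x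
    change x = 0
    revert x
    rw [h]
    exact fun _ => rfl

/-- `P` restricts to `S` on the window `0, …, m + 1`, moved up by one position. -/
structure Persistence.Restricts {n : ℕ} (P : Persistence k n) (m : ℕ) (S : DSeq k) where
  ι : ∀ i, Fam (S.A i) (P.U (i + 1))
  π : ∀ i, Fam (P.U (i + 1)) (S.A i)
  isChain_ι : ∀ i ≤ m + 1, IsChain (ι i)
  isChain_π : ∀ i ≤ m + 1, IsChain (π i)
  π_ι : ∀ i ≤ m + 1, ∀ p x, π i p (ι i p x) = x
  ι_π : ∀ i ≤ m + 1, ∀ p x, ι i p (π i p x) = x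
  u_ι : ∀ i ≤ m, ∀ p x, P.u (i + 1) (i + 1 + 1) p (ι i p x) = ι (i + 1) p (S.a i p x)

theorem gate_of_eq_true {b : Bool} (A : DCx k) (h : b = true) :
    IsChain (gateIn b A) ∧ IsChain (gateOut b A) ∧
      (∀ p x, gateOut b A p (gateIn b A p x) = x) ∧
      ∀ p x, gateIn b A p (gateOut b A p x) = x := by
  subst h
  exact ⟨fun _ _ => rfl, fun _ _ => rfl, fun _ _ => rfl, fun _ _ => rfl⟩

/-- The persistence object of a sequence restricts to it. -/
def DSeq.restricts {m : ℕ} {S : DSeq k} (hA : ∀ i ≤ m + 1, IsCplx (S.A i)) (hS : S.Valid m) :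
    (DSeq.persistence hA hS).Restricts m S where
  ι i := gateIn _ (S.A i)
  π i := gateOut _ (S.A i)
  isChain_ι i hi := (gate_of_eq_true _ (decide_eq_true hi)).1
  isChain_π i hi := (gate_of_eq_true _ (decide_eq_true hi)).2.1
  π_ι i hi := (gate_of_eq_true _ (decide_eq_true hi)).2.2.1
  ι_π i hi := (gate_of_eq_true _ (decide_eq_true hi)).2.2.2
  u_ι i hi p x := by
    change (S.trunc m).hom (i + 1) (i + 1 + 1) p _ = _
    rw [hom_succ _ le_rfl, hom_self]
    change gateIn _ _ p (S.a i p (gateOut _ _ p (gateIn _ _ p x))) = _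
    rw [(gate_of_eq_true _ (decide_eq_true (by omega : i ≤ m + 1))).2.2.1]
    rfl

/-- The double shift of a sequence. -/
def DSeq.shift2 (S : DSeq k) : DSeq k where
  A i := shift (shift (S.A i))
  a i := shiftF (shiftF (S.a i))

namespace Persistence.Restricts

variable {m n : ℕ} {P : Persistence k n} {S : DSeq k}

theorem equiv_row_zero (R : P.Restricts m S) (hn : n = m + 3) : S.Equiv m (P.row 0) := by
  have z0 : ∀ p (x : (P.U 0).X p), x = 0 := P.eq_zero_of_eq rfl
  let φ : ∀ i, Fam (S.A i) (P.obj 0 (0 + 1 + i)) := fun i p =>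
    LinearMap.prod 0 (LinearMap.prod ((P.u (i + 1) (0 + 1 + i) p).comp (R.ι i p)) 0)
  let ψ : ∀ i, Fam (P.obj 0 (0 + 1 + i)) (S.A i) := fun i p =>
    ((R.π i p).comp (P.u (0 + 1 + i) (i + 1) p)).comp
      ((LinearMap.fst k _ _).comp (LinearMap.snd k ((P.U 0).X (p + 1)) _))
  refine ⟨φ, fun i hi => ?_, fun i hi => .of_eq fun p x => ?_⟩
  · have zi : ∀ p (x : (P.U (0 + 1 + i - n)).X p), x = 0 := P.eq_zero_of_eq (by omega)
    refine IsHE.of_strict (g := ψ i) ?_ ?_ ?_ ?_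
    · refine fun p x => Prod.ext ((z0 _ _).trans (z0 _ _).symm)
        (Prod.ext ?_ ((zi _ _).trans (zi _ _).symm))
      change P.u 0 (0 + 1 + i) (p + 1) 0 +
        (P.U (0 + 1 + i)).d p (P.u (i + 1) (0 + 1 + i) p (R.ι i p x)) =
        P.u (i + 1) (0 + 1 + i) (p + 1) (R.ι i (p + 1) ((S.A i).d p x))
      rw [map_zero, P.isChain, R.isChain_ι i hi]
      exact zero_add _
    · rintro p ⟨x, y, z⟩
      obtain rfl := z0 _ x
      change (S.A i).d p (R.π i p (P.u (0 + 1 + i) (i + 1) p y)) =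
        R.π i (p + 1) (P.u (0 + 1 + i) (i + 1) (p + 1)
          (P.u 0 (0 + 1 + i) (p + 1) 0 + (P.U (0 + 1 + i)).d p y))
      rw [map_zero, zero_add ((P.U (0 + 1 + i)).d p y), ← P.isChain, R.isChain_π i hi]
    · intro p x
      change R.π i p (P.u (0 + 1 + i) (i + 1) p (P.u (i + 1) (0 + 1 + i) p (R.ι i p x))) = x
      rw [P.u_u (by omega) (by omega), P.u_self, R.π_ι i hi]
    · rintro p ⟨x, y, z⟩
      refine Prod.ext ((z0 _ _).trans (z0 _ _).symm)
        (Prod.ext ?_ ((zi _ _).trans (zi _ _).symm))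
      change P.u (i + 1) (0 + 1 + i) p (R.ι i p (R.π i p (P.u (0 + 1 + i) (i + 1) p y))) = y
      rw [R.ι_π i hi, P.u_u (by omega) (by omega), P.u_self]
  · have zi : ∀ p (x : (P.U (0 + 1 + (i + 1) - n)).X p), x = 0 := P.eq_zero_of_eq (by omega)
    refine Prod.ext ((z0 _ _).trans (z0 _ _).symm) (Prod.ext ?_ ((zi _ _).trans (zi _ _).symm))
    change P.u (i + 1 + 1) (0 + 1 + (i + 1)) p (R.ι (i + 1) p (S.a i p x)) =
      P.u (0 + 1 + i) (0 + 1 + (i + 1)) p (P.u (i + 1) (0 + 1 + i) p (R.ι i p x))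
    rw [← R.u_ι i hi, P.u_u (by omega) (by omega), P.u_u (by omega) (by omega)]

theorem row_equiv_shift2 (R : P.Restricts m S) : (P.row n).Equiv m S.shift2 := by
  have z0 : ∀ p (x : (P.U n).X p), x = 0 := P.eq_zero_of_le le_rfl
  let ψ : ∀ i, Fam (shift (shift (S.A i))) (P.obj n (n + 1 + i)) := fun i p =>
    LinearMap.prod 0 (LinearMap.prod 0
      ((P.u (i + 1) (n + 1 + i - n) (p + 1 + 1)).comp (R.ι i (p + 1 + 1))))
  let φ : ∀ i, Fam (P.obj n (n + 1 + i)) (shift (shift (S.A i))) := fun i p =>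
    ((R.π i (p + 1 + 1)).comp (P.u (n + 1 + i - n) (i + 1) (p + 1 + 1))).comp
      ((LinearMap.snd k _ _).comp (LinearMap.snd k ((P.U n).X (p + 1)) _))
  refine ⟨φ, fun i hi => ?_, fun i hi => .of_eq ?_⟩
  · have zi : ∀ p (x : (P.U (n + 1 + i)).X p), x = 0 := P.eq_zero_of_le (by omega)
    refine IsHE.of_strict (g := ψ i) ?_ ?_ ?_ ?_
    · rintro p ⟨x, y, z⟩
      change - -(S.A i).d (p + 1 + 1) (R.π i (p + 1 + 1) (P.u (n + 1 + i - n) (i + 1) _ z)) =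
        R.π i (p + 1 + 1 + 1) (P.u (n + 1 + i - n) (i + 1) (p + 1 + 1 + 1)
          ((P.U (n + 1 + i - n)).d (p + 1 + 1) z))
      rw [neg_neg, ← P.isChain, R.isChain_π i hi]
    · refine fun p (x : (S.A i).X (p + 1 + 1)) => Prod.ext ((z0 _ _).trans (z0 _ _).symm)
        (Prod.ext ((zi _ _).trans (zi _ _).symm) ?_)
      change (P.U (n + 1 + i - n)).d (p + 1 + 1)
          (P.u (i + 1) (n + 1 + i - n) (p + 1 + 1) (R.ι i (p + 1 + 1) x)) =
        P.u (i + 1) (n + 1 + i - n) (p + 1 + 1 + 1)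
          (R.ι i (p + 1 + 1 + 1) (- -(S.A i).d (p + 1 + 1) x))
      rw [neg_neg, P.isChain, R.isChain_ι i hi]
    · rintro p ⟨x, y, z⟩
      refine Prod.ext ((z0 _ _).trans (z0 _ _).symm)
        (Prod.ext ((zi _ _).trans (zi _ _).symm) ?_)
      change P.u (i + 1) (n + 1 + i - n) _ (R.ι i _ (R.π i _
        (P.u (n + 1 + i - n) (i + 1) (p + 1 + 1) z))) = z
      rw [R.ι_π i hi, P.u_u (by omega) (by omega), P.u_self]
    · intro p (x : (S.A i).X (p + 1 + 1))
      change R.π i _ (P.u (n + 1 + i - n) (i + 1) _ (P.u (i + 1) (n + 1 + i - n) (p + 1 + 1)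
        (R.ι i (p + 1 + 1) x))) = x
      rw [P.u_u (by omega) (by omega), P.u_self, R.π_ι i hi]
  · rintro p ⟨x, y, z⟩
    change R.π (i + 1) (p + 1 + 1) (P.u (n + 1 + (i + 1) - n) (i + 1 + 1) (p + 1 + 1)
        (P.u (n + 1 + i - n) (n + 1 + (i + 1) - n) (p + 1 + 1) z)) =
      S.a i (p + 1 + 1) (R.π i (p + 1 + 1) (P.u (n + 1 + i - n) (i + 1) (p + 1 + 1) z))
    rw [← R.π_ι (i + 1) (by omega) _ (S.a i _ _), ← R.u_ι i hi, R.ι_π i (by omega),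
      P.u_u (by omega) (by omega), P.u_u (by omega) (by omega)]

end Persistence.Restricts

end DCx

/-- A graded object, keeping only the components of the differential of degree one. -/
def Cx.toD (A : Cx k) : DCx k where
  X := A.X
  d p := A.d p (p + 1)

/-- The degree-`0` components of a graded morphism. -/
def Mor.toF {A B : Cx k} (f : Mor A B) : DCx.Fam A.toD B.toD := fun p => f p p

/-- The underlying sequence of degree-`0` families. -/
def Seq.toD (S : Seq k) : DCx.DSeq k where
  A i := (S.A i).toD
  a i := (S.a i).toF

theorem Mor.comp_apply {A B C : Cx k} (g : Mor B C) (f : Mor A B) {m i j : ℤ} (l : ℤ)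
    (h : j = i + m) (x : A.X i) : Mor.comp g f m i l x = g j l (f i j x) := by
  subst h
  rfl

theorem Mor.diff_apply {A B : Cx k} (f : Mor A B) {n i j : ℤ} (l : ℤ) (h : j = i + n)
    (x : A.X i) : Mor.diff n f i l x =
      B.d j l (f i j x) - (n.negOnePow : ℤ) • f (i + 1) l (A.d i (i + 1) x) := by
  subst h
  rfl

theorem idM_self (A : Cx k) (i : ℤ) : idM A i i = LinearMap.id := by
  rw [idM, dif_pos rfl]
  rfl

theorem idM_of_ne (A : Cx k) {i j : ℤ} (h : i ≠ j) : idM A i j = 0 := dif_neg h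

theorem Mor.toF_comp {A B C : Cx k} (g : Mor B C) (f : Mor A B) :
    (Mor.comp g f 0).toF = DCx.Fam.comp g.toF f.toF := by
  funext p
  exact LinearMap.ext fun x => Mor.comp_apply g f p (add_zero p).symm x

theorem Mor.toF_idM (A : Cx k) : (idM A).toF = DCx.idF A.toD := by
  funext p
  exact idM_self A p

theorem Seq.abar_toD (S : Seq k) : ∀ i, S.toD.abar i = (S.abar i).toF
  | 0 => rfl
  | i + 1 => by
    rw [DCx.DSeq.abar, Seq.abar_toD S i, Seq.abar, Mor.toF_comp]
    rfl

theorem Cx.IsComplex.toD {A : Cx k} (hA : A.IsComplex) : DCx.IsCplx A.toD := fun p x =>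
  LinearMap.congr_fun (hA.2 p (p + 1) (p + 1 + 1)) x

theorem Mor.diff_zero_toF {A B : Cx k} (f : Mor A B) (p : ℤ) (x : A.X p) :
    Mor.diff 0 f p (p + 1) x = B.d p (p + 1) (f p p x) - f (p + 1) (p + 1) (A.d p (p + 1) x) := by
  rw [Mor.diff_apply f _ (add_zero p).symm]
  simp

theorem IsChainMap.toF {A B : Cx k} {f : Mor A B} (hf : IsChainMap f) : DCx.IsChain f.toF := by
  intro p (x : A.X p)
  have h : Mor.diff 0 f p (p + 1) x = 0 :=
    LinearMap.congr_fun (congrFun (congrFun hf.2 p) (p + 1)) x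
  rw [Mor.diff_zero_toF] at h
  exact sub_eq_zero.mp h

/-- A criterion for being a chain map in terms of degree-`0` components. -/
theorem isChainMap_of {A B : Cx k} (hB : B.IsComplex) {f : Mor A B}
    (h : f.HasDeg 0) (hf : DCx.IsChain f.toF) : IsChainMap f := by
  refine ⟨h, ?_⟩
  funext i j
  refine LinearMap.ext fun x => ?_
  by_cases hj : i + 1 = j
  · subst hj
    rw [Mor.diff_zero_toF]
    exact sub_eq_zero.mpr (hf i x)
  · rw [Mor.diff_apply f _ (add_zero i).symm, hB.1 i j hj, h (i + 1) j (by omega)]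
    simp

theorem Mor.HasDeg.comp {A B C : Cx k} {g : Mor B C} {f : Mor A B} (hg : g.HasDeg 0) :
    (Mor.comp g f 0).HasDeg 0 := fun i j h => by
  rw [Mor.comp, hg _ _ (by omega), LinearMap.zero_comp]

theorem IsChainMap.comp {A B C : Cx k} {g : Mor B C} {f : Mor A B}
    (hC : C.IsComplex) (hg : IsChainMap g) (hf : IsChainMap f) : IsChainMap (Mor.comp g f 0) :=
  isChainMap_of hC hg.1.comp (by rw [Mor.toF_comp]; exact hg.toF.comp hf.toF)

theorem isComplex_of {A : Cx k} (h : ∀ i j : ℤ, i + 1 ≠ j → A.d i j = 0)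
    (hA : DCx.IsCplx A.toD) : A.IsComplex := by
  refine ⟨h, fun i j l => ?_⟩
  by_cases hj : i + 1 = j
  · subst hj
    by_cases hl : i + 1 + 1 = l
    · subst hl
      exact LinearMap.ext fun x => hA i x
    · rw [h _ _ hl, LinearMap.zero_comp]
  · rw [h _ _ hj, LinearMap.comp_zero]

theorem isComplex_cone {A B : Cx k} {a : Mor A B} (hA : A.IsComplex) (hB : B.IsComplex)
    (ha : IsChainMap a) : (cone a).IsComplex := by
  refine isComplex_of (fun i j h => ?_) ?_
  · refine LinearMap.ext ?_
    rintro ⟨x, y⟩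
    refine Prod.ext ?_ ?_
    · change -A.d (i + 1) (j + 1) x = 0
      rw [hA.1 _ _ (by omega), LinearMap.zero_apply, neg_zero]
    · change a (i + 1) j x + B.d i j y = 0
      rw [hB.1 _ _ h, ha.1 _ _ (by omega), LinearMap.zero_apply, LinearMap.zero_apply, add_zero]
  · exact DCx.isCplx_cone hA.toD hB.toD ha.toF

theorem isComplex_shiftCx {A : Cx k} (hA : A.IsComplex) (n : ℤ) : (shiftCx A n).IsComplex := by
  refine ⟨fun i j h => ?_, fun i j l => ?_⟩
  · change (n.negOnePow : ℤ) • A.d (i + n) (j + n) = 0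
    rw [hA.1 _ _ (by omega), smul_zero]
  · refine LinearMap.ext fun x => ?_
    change (n.negOnePow : ℤ) • A.d (j + n) (l + n)
      ((n.negOnePow : ℤ) • A.d (i + n) (j + n) x) = 0
    have : A.d (j + n) (l + n) (A.d (i + n) (j + n) x) = 0 :=
      LinearMap.congr_fun (hA.2 (i + n) (j + n) (l + n)) x
    rw [map_zsmul, this, smul_zero, smul_zero]

theorem shiftCx_one_d (A : Cx k) (i j : ℤ) (x : A.X (i + 1)) :
    (shiftCx A 1).d i j x = -A.d (i + 1) (j + 1) x := by
  change ((1 : ℤ).negOnePow : ℤ) • A.d (i + 1) (j + 1) x = _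
  simp

/-- The identification of the two versions of the shift by one. -/
def shiftId (A : Cx k) : DCx.Fam (DCx.shift A.toD) (shiftCx A 1).toD := fun _ => LinearMap.id

theorem isHE_shiftId (A : Cx k) : DCx.IsHE (shiftId A) := by
  let g : DCx.Fam (shiftCx A 1).toD (DCx.shift A.toD) := fun _ => LinearMap.id
  refine DCx.IsHE.of_strict (g := g) (fun p x => ?_) (fun p x => ?_) (fun _ _ => rfl)
    (fun _ _ => rfl)
  · exact shiftCx_one_d A p (p + 1) x
  · exact (shiftCx_one_d A p (p + 1) x).symm

/-- Validity of the initial window `0, …, m + 1` of a sequence. -/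
structure Seq.Valid (m : ℕ) (S : Seq k) : Prop where
  isComplex : ∀ i ≤ m + 1, (S.A i).IsComplex
  isChainMap : ∀ i ≤ m, IsChainMap (S.a i)

theorem Seq.Valid.toD {m : ℕ} {S : Seq k} (hS : S.Valid m) : S.toD.Valid m := fun i hi =>
  (hS.isChainMap i hi).toF

theorem Seq.Valid.abar {m : ℕ} {S : Seq k} (hS : S.Valid m) : ∀ i ≤ m, IsChainMap (S.abar i)
  | 0, h => hS.isChainMap 0 h
  | i + 1, h => IsChainMap.comp (hS.isComplex (i + 2) (by omega))
      (hS.isChainMap (i + 1) h) (Seq.Valid.abar hS i (by omega))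

theorem coxA_of_le {m i : ℕ} (S : Seq k) (hi : i ≤ m) : coxA (m + 3) S i = cone (S.abar i) :=
  if_pos (by omega)

theorem coxA_last (m : ℕ) (S : Seq k) : coxA (m + 3) S (m + 1) = shiftCx (S.A 0) 1 := by
  rw [coxA, if_neg (by omega), if_pos rfl]

/-- The projection `(id, 0)` from the cone. -/
def projM {A B : Cx k} (a : Mor A B) : Mor (cone a) (shiftCx A 1) := fun p q =>
  (idM A (p + 1) (q + 1)).comp (LinearMap.fst k (A.X (p + 1)) (B.X p))

theorem coxa_of_lt {m i : ℕ} (S : Seq k) (hi : i < m) :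
    HEq (coxa (m + 3) S i) (coneMap (S.abar i) (S.abar (i + 1)) (idM (S.A 0)) 0 (S.a (i + 1))) := by
  unfold coxa
  simp only [eq_mpr_eq_cast]
  rw [dif_pos (by omega), dif_pos (by omega)]
  exact cast_heq _ _ |>.trans (cast_heq _ _)

theorem coxa_last (m : ℕ) (S : Seq k) :
    HEq (coxa (m + 3) S m) (projM (S.abar m)) := by
  unfold coxa
  simp only [eq_mpr_eq_cast]
  rw [dif_pos (by omega), dif_neg (by omega), dif_pos trivial]
  exact cast_heq _ _ |>.trans (cast_heq _ _ |>.trans (cast_heq _ _))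

theorem IsChainMap.of_heq {A A' B B' : Cx k} (hA : A' = A) (hB : B' = B) {f : Mor A B}
    {f' : Mor A' B'} (h : HEq f' f) (hf : IsChainMap f) : IsChainMap f' := by
  subst hA hB
  cases h
  exact hf

theorem toF_coneMap {A B A' B' : Cx k} (a : Mor A B) (b : Mor A' B') (f : Mor A A')
    (g : Mor B B') :
    (coneMap a b f 0 g).toF = DCx.coneMap a.toF b.toF f.toF 0 g.toF := rfl

theorem toF_projM {A B : Cx k} (a : Mor A B) :
    (projM a).toF = DCx.Fam.comp (shiftId A) (DCx.coneFst a.toF) := by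
  funext p
  refine LinearMap.ext fun x => ?_
  change idM A (p + 1) (p + 1) x.1 = x.1
  rw [idM_self]
  rfl

theorem isChainMap_projM {A B : Cx k} (a : Mor A B) (hA : A.IsComplex) :
    IsChainMap (projM a) := by
  refine isChainMap_of (isComplex_shiftCx hA 1) (fun i j h => ?_) ?_
  · rw [projM, idM_of_ne A (by omega)]
    exact LinearMap.zero_comp _
  · rw [toF_projM]
    exact (isHE_shiftId A).1.comp (DCx.isChain_coneFst _)

theorem isChainMap_coneMap_diag {m i : ℕ} {S : Seq k} (hS : S.Valid m) (hi : i < m) :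
    IsChainMap (coneMap (S.abar i) (S.abar (i + 1)) (idM (S.A 0)) 0 (S.a (i + 1))) := by
  refine isChainMap_of (isComplex_cone (hS.isComplex 0 (by omega)) (hS.isComplex _ (by omega))
    (hS.abar _ hi)) (fun p q h => LinearMap.ext ?_) ?_
  · rintro ⟨x, y⟩
    refine Prod.ext ?_ ?_
    · change idM (S.A 0) (p + 1) (q + 1) x = 0
      rw [idM_of_ne _ (by omega), LinearMap.zero_apply]
    · change 0 + S.a (i + 1) p q y = 0
      rw [(hS.isChainMap (i + 1) hi).1 _ _ h, LinearMap.zero_apply, add_zero]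
  · rw [toF_coneMap, Mor.toF_idM]
    refine DCx.isChain_coneMap_diag (DCx.isChain_id _) (hS.isChainMap (i + 1) hi).toF fun p x => ?_
    rw [Seq.abar, Mor.toF_comp]
    rfl

theorem Seq.Valid.cox {m : ℕ} {S : Seq k} (hS : S.Valid m) : (cox (m + 3) S).Valid m := by
  refine ⟨fun i hi => ?_, fun i hi => ?_⟩
  · obtain hi | rfl := Nat.le_succ_iff.mp hi
    · change (coxA (m + 3) S i).IsComplex
      rw [coxA_of_le S hi]
      exact isComplex_cone (hS.isComplex _ (by omega)) (hS.isComplex _ (by omega)) (hS.abar i hi)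
    · change (coxA (m + 3) S (m + 1)).IsComplex
      rw [coxA_last]
      exact isComplex_shiftCx (hS.isComplex _ (by omega)) 1
  · obtain hi' | rfl := Nat.lt_or_eq_of_le hi
    · exact (isChainMap_coneMap_diag hS hi').of_heq (coxA_of_le S hi) (coxA_of_le S hi')
        (coxa_of_lt S hi')
    · exact (isChainMap_projM _ (hS.isComplex _ (by omega))).of_heq (coxA_of_le S hi)
        (coxA_last i S) (coxa_last i S)

/-- Transport along an equality of graded objects. -/
def eqFam {A B : Cx k} (h : A = B) : DCx.Fam A.toD B.toD := fun p =>
  h ▸ (LinearMap.id : A.X p →ₗ[k] A.X p)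

theorem isHE_eqFam {A B : Cx k} (h : A = B) : DCx.IsHE (eqFam h) := by
  subst h
  exact DCx.IsHE.of_strict (g := eqFam rfl) (fun _ _ => rfl) (fun _ _ => rfl) (fun _ _ => rfl)
    (fun _ _ => rfl)

theorem eqFam_comp {A A' B B' : Cx k} (hA : A' = A) (hB : B' = B) {f : Mor A B}
    {f' : Mor A' B'} (h : HEq f' f) :
    DCx.Fam.comp (eqFam hB.symm) f.toF = DCx.Fam.comp f'.toF (eqFam hA.symm) := by
  subst hA hB
  cases h
  rfl

theorem nonempty_isCoxeter_cox (m : ℕ) (S : Seq k) :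
    Nonempty (S.toD.IsCoxeter m (cox (m + 3) S).toD) := by
  let θ : ∀ i, DCx.Fam (cone (S.abar i)).toD (coxA (m + 3) S i).toD := fun i =>
    if h : i ≤ m then eqFam (coxA_of_le S h).symm else 0
  let l : ∀ i, DCx.Fam (DCx.shift (S.A 0).toD) (coxA (m + 3) S i).toD := fun i =>
    if h : i = m + 1 then DCx.Fam.comp
      (eqFam (show shiftCx (S.A 0) 1 = coxA (m + 3) S i by rw [h, coxA_last])) (shiftId _) else 0
  have hθ : ∀ i (h : i ≤ m), θ i = eqFam (coxA_of_le S h).symm := fun i h => dif_pos h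
  have hl : l (m + 1) = DCx.Fam.comp (eqFam (coxA_last m S).symm) (shiftId _) := dif_pos rfl
  refine DCx.DSeq.IsCoxeter.nonempty_of_abar_eq (fun i => (S.abar i).toF) (funext S.abar_toD)
    θ l (fun i hi => ?_) ?_ (fun i hi => ?_) ?_
  · rw [hθ i hi]
    exact isHE_eqFam _
  · rw [hl]
    exact (isHE_eqFam _).comp (isHE_shiftId _)
  · rw [hθ i hi.le, hθ (i + 1) hi]
    refine .of_eq fun p x => ?_
    have e := eqFam_comp (coxA_of_le S hi.le) (coxA_of_le S hi) (coxa_of_lt S hi)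
    rw [toF_coneMap, Mor.toF_idM] at e
    exact LinearMap.congr_fun (congrFun e p) x
  · rw [hθ m le_rfl, hl]
    refine .of_eq fun p x => ?_
    have e := eqFam_comp (coxA_of_le S le_rfl) (coxA_last m S) (coxa_last m S)
    rw [toF_projM] at e
    exact LinearMap.congr_fun (congrFun e p) x

theorem idM_idM (A : Cx k) {i j : ℤ} (h : i = j) (x : A.X i) : idM A j i (idM A i j x) = x := by
  subst h
  rw [idM_self]
  rfl

theorem d_idM (A : Cx k) {i i' j j' : ℤ} (hi : i = i') (hj : j = j') (x : A.X i) :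
    A.d i' j' (idM A i i' x) = idM A j j' (A.d i j x) := by
  subst hi hj
  rw [idM_self, idM_self]
  rfl

theorem Mor.apply_idM {A B : Cx k} (f : Mor A B) {i i' : ℤ} (hi : i = i') (x : A.X i) :
    f i' i' (idM A i i' x) = idM B i i' (f i i x) := by
  subst hi
  rw [idM_self, idM_self]
  rfl

/-- The identification of the two versions of the double shift. -/
def shiftTwoId (A : Cx k) : DCx.Fam (DCx.shift (DCx.shift A.toD)) (shiftCx A 2).toD := fun p =>
  idM A (p + 1 + 1) (p + 2)

theorem shiftCx_two_d (A : Cx k) (i j : ℤ) (x : A.X (i + 2)) :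
    (shiftCx A 2).d i j x = A.d (i + 2) (j + 2) x := by
  change ((2 : ℤ).negOnePow : ℤ) • A.d (i + 2) (j + 2) x = _
  rw [Int.negOnePow_even 2 even_two, Units.val_one, one_smul]

theorem isHE_shiftTwoId (A : Cx k) : DCx.IsHE (shiftTwoId A) := by
  let g : DCx.Fam (shiftCx A 2).toD (DCx.shift (DCx.shift A.toD)) := fun p =>
    idM A (p + 2) (p + 1 + 1)
  have e : ∀ p : ℤ, p + 1 + 1 = p + 2 := fun p => by ring
  refine DCx.IsHE.of_strict (g := g) (fun p (x : A.X (p + 1 + 1)) => ?_)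
    (fun p (x : A.X (p + 2)) => ?_) (fun p x => idM_idM A (e p) x)
    (fun p x => idM_idM A (e p).symm x)
  · refine (shiftCx_two_d A p (p + 1) _).trans ((d_idM A (e p) (e (p + 1)) x).trans ?_)
    change _ = idM A _ _ (- -A.d (p + 1 + 1) (p + 1 + 1 + 1) x)
    rw [neg_neg]
  · change - -A.d (p + 1 + 1) (p + 1 + 1 + 1) (idM A (p + 2) (p + 1 + 1) x) =
      idM A (p + 1 + 2) (p + 1 + 1 + 1) ((shiftCx A 2).d p (p + 1) x)
    rw [neg_neg, d_idM A (e p).symm (e (p + 1)).symm, shiftCx_two_d]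

theorem Seq.equiv_shift2 (m : ℕ) (S : Seq k) : S.toD.shift2.Equiv m S.shift2.toD :=
  ⟨fun i => shiftTwoId (S.A i), fun _ _ => isHE_shiftTwoId _, fun i _ => .of_eq fun p x =>
    (Mor.apply_idM (S.a i) (by ring : p + 1 + 1 = p + 2) x).symm⟩

theorem Seq.Valid.iterate_cox {m : ℕ} {S : Seq k} (hS : S.Valid m) :
    ∀ j : ℕ, ((ThesisDG.cox (m + 3))^[j] S).Valid m
  | 0 => hS
  | j + 1 => by
    rw [Function.iterate_succ_apply']
    exact (hS.iterate_cox j).cox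

/-- The iterated Coxeter transforms are the rows of the associated persistence object. -/
theorem Seq.Valid.equiv_row {m : ℕ} {S : Seq k} (hS : S.Valid m)
    {P : DCx.Persistence k (m + 3)} (R : P.Restricts m S.toD) :
    ∀ j ≤ m + 3, ((ThesisDG.cox (m + 3))^[j] S).toD.Equiv m (P.row j)
  | 0, _ => R.equiv_row_zero rfl
  | j + 1, hj => by
    obtain ⟨c⟩ := nonempty_isCoxeter_cox m ((ThesisDG.cox (m + 3))^[j] S)
    obtain ⟨c'⟩ := P.nonempty_isCoxeter_row rfl hj
    rw [Function.iterate_succ_apply']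
    exact (hS.equiv_row R j (by omega)).coxeter (hS.iterate_cox j).toD (P.valid_row rfl)
      (hS.iterate_cox j).cox.toD c c'

theorem Seq.Valid.equiv_shift2 {m : ℕ} {S : Seq k} (hS : S.Valid m) :
    ((ThesisDG.cox (m + 3))^[m + 3] S).toD.Equiv m S.shift2.toD := by
  have R := DCx.DSeq.restricts (fun i hi => (hS.isComplex i hi).toD) hS.toD
  exact ((hS.equiv_row R _ le_rfl).trans R.row_equiv_shift2).trans (S.equiv_shift2 m)

/-- The degree-`0` morphism with given components. -/
def Mor.ofF {A B : Cx k} (f : DCx.Fam A.toD B.toD) : Mor A B := fun i j =>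
  (idM B i j).comp (f i)

theorem Mor.toF_ofF {A B : Cx k} (f : DCx.Fam A.toD B.toD) : (Mor.ofF f).toF = f := by
  funext p
  change (idM B p p).comp (f p) = f p
  rw [idM_self]
  rfl

theorem Mor.hasDeg_ofF {A B : Cx k} (f : DCx.Fam A.toD B.toD) : (Mor.ofF f).HasDeg 0 :=
  fun i j h => by
    rw [Mor.ofF, idM_of_ne B (by omega)]
    exact LinearMap.zero_comp _

theorem exists_diff_eq {A B : Cx k} (hB : B.IsComplex) {f g : Mor A B} (hf : f.HasDeg 0)
    (hg : g.HasDeg 0) (h : DCx.Htpic f.toF g.toF) :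
    ∃ s : Mor A B, s.HasDeg (-1) ∧ Mor.diff (-1) s = f - g := by
  obtain ⟨t, ht⟩ := h
  let s : Mor A B := fun i j => (t j).comp (idM A i (j + 1))
  have hs : s.HasDeg (-1) := fun i j h => by
    change (t j).comp (idM A i (j + 1)) = 0
    rw [idM_of_ne A (by omega)]
    exact LinearMap.comp_zero _
  have hst : ∀ p x, s (p + 1) p x = t p x := fun p x => by
    change t p (idM A (p + 1) (p + 1) x) = t p x
    rw [idM_self]
    rfl
  refine ⟨s, hs, ?_⟩
  funext i j
  obtain ⟨p, rfl⟩ : ∃ p, i = p + 1 := ⟨i - 1, by ring⟩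
  refine LinearMap.ext fun x => ?_
  rw [Mor.diff_apply s (j := p) j (by ring), Int.negOnePow_neg, Int.negOnePow_one, Units.val_neg,
    Units.val_one, neg_one_smul, sub_neg_eq_add]
  change _ = f (p + 1) j x - g (p + 1) j x
  by_cases hj : p + 1 = j
  · subst hj
    rw [hst, hst]
    exact ht p x
  · rw [hB.1 p j hj, hs (p + 1 + 1) j (by omega), hf _ _ (by omega), hg _ _ (by omega)]
    simp

theorem Mor.hasDeg_idM (A : Cx k) : (idM A).HasDeg 0 := fun _ _ h => idM_of_ne A (by omega)

theorem isHtpyEquiv_ofF {A B : Cx k} (hA : A.IsComplex) (hB : B.IsComplex)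
    {f : DCx.Fam A.toD B.toD} (h : DCx.IsHE f) : IsHtpyEquiv (Mor.ofF f) := by
  obtain ⟨cf, g, cg, h1, h2⟩ := h
  refine ⟨Mor.ofF g, isChainMap_of hB (Mor.hasDeg_ofF f) (by rwa [Mor.toF_ofF]),
    isChainMap_of hA (Mor.hasDeg_ofF g) (by rwa [Mor.toF_ofF]), ?_, ?_⟩
  · exact exists_diff_eq hA (Mor.hasDeg_ofF g).comp (Mor.hasDeg_idM A)
      (by rwa [Mor.toF_comp, Mor.toF_ofF, Mor.toF_ofF, Mor.toF_idM])
  · exact exists_diff_eq hB (Mor.hasDeg_ofF f).comp (Mor.hasDeg_idM B)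
      (by rwa [Mor.toF_comp, Mor.toF_ofF, Mor.toF_ofF, Mor.toF_idM])

/-- The `n`-fold iterate of the Coxeter transform applied to the sequence
`A₀ → ⋯ → A_{n-2}` is homotopy equivalent to the shifted sequence
`A₀[2] → ⋯ → A_{n-2}[2]`: there are componentwise homotopy equivalences `φᵢ`
together with degree `-1` morphisms `hᵢ` making all squares commute up to the
specified homotopies. -/
theorem statement_12 (n : ℕ) (hn : 3 ≤ n) (S : Seq k)
    (hA : ∀ i : ℕ, i ≤ n - 2 → (S.A i).IsComplex)
    (ha : ∀ i : ℕ, i ≤ n - 3 → IsChainMap (S.a i)) :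
    ∃ (φ : ∀ i : ℕ, Mor (((cox n)^[n] S).A i) (S.shift2.A i))
      (h : ∀ i : ℕ, Mor (((cox n)^[n] S).A i) (S.shift2.A (i + 1))),
      (∀ i, i ≤ n - 2 → IsHtpyEquiv (φ i)) ∧
      ∀ i, i ≤ n - 3 → Mor.HasDeg (h i) (-1) ∧
        Mor.diff (-1) (h i) =
          Mor.comp (φ (i + 1)) (((cox n)^[n] S).a i) 0 -
            Mor.comp (S.shift2.a i) (φ i) 0 := by
  obtain ⟨m, rfl⟩ : ∃ m, n = m + 3 := ⟨n - 3, by omega⟩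
  have hS : S.Valid m := ⟨fun i hi => hA i (by omega), fun i hi => ha i (by omega)⟩
  have hT := hS.iterate_cox (m + 3)
  have hS2 : ∀ i ≤ m + 1, (S.shift2.A i).IsComplex := fun i hi =>
    isComplex_shiftCx (hS.isComplex i hi) 2
  obtain ⟨φ, hφ, e⟩ : ∃ φ : ∀ i, DCx.Fam (((cox (m + 3))^[m + 3] S).A i).toD (S.shift2.A i).toD,
      (∀ i ≤ m + 1, DCx.IsHE (φ i)) ∧ ∀ i ≤ m, DCx.Htpic
        (DCx.Fam.comp (φ (i + 1)) (((cox (m + 3))^[m + 3] S).a i).toF)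
        (DCx.Fam.comp (S.shift2.a i).toF (φ i)) := hS.equiv_shift2
  have hs : ∀ i, ∃ s : Mor (((cox (m + 3))^[m + 3] S).A i) (S.shift2.A (i + 1)), i ≤ m →
      s.HasDeg (-1) ∧ Mor.diff (-1) s =
        Mor.comp (Mor.ofF (φ (i + 1))) (((cox (m + 3))^[m + 3] S).a i) 0 -
          Mor.comp (S.shift2.a i) (Mor.ofF (φ i)) 0 := by
    intro i
    by_cases hi : i ≤ m
    · have h2 : (S.shift2.a i).HasDeg 0 := fun p q h =>
        (hS.isChainMap i hi).1 (p + 2) (q + 2) (by omega)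
      obtain ⟨s, hs⟩ := exists_diff_eq (f := Mor.comp (Mor.ofF (φ (i + 1))) (Seq.a _ i) 0)
        (hS2 (i + 1) (by omega)) (Mor.hasDeg_ofF (φ (i + 1))).comp (h2.comp (f := Mor.ofF (φ i)))
        (by rw [Mor.toF_comp, Mor.toF_comp, Mor.toF_ofF, Mor.toF_ofF]; exact e i hi)
      exact ⟨s, fun _ => hs⟩
    · exact ⟨0, fun h => absurd h hi⟩
  choose s hs using hs
  exact ⟨fun i => Mor.ofF (φ i), s, fun i hi =>
    isHtpyEquiv_ofF (hT.isComplex i (by omega)) (hS2 i (by omega)) (hφ i (by omega)),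
    fun i hi => hs i (by omega)⟩

end ThesisDG
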